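/- Let $\beta\in\{1,2\}$, $r\geq\beta$, and $M\geq 128$ integers, and suppose $x\in[0,1]^N$ is such that $D_1^{\beta}x$ satisfies the $\Lambda_M$-minimum separation condition with support $S=\{m_1,\dots,m_s\}\subseteq\{0,\dots,N-1\}$, and set $\xi_j=m_j/N$. Let $q\in\mathbb{R}^N$ be feasible for $x$ (i.e. $\|D^{-r}(x-q)\|_\infty\leq\delta/2$) and let $\hat{x}$ minimize $\|D_1^{\beta}z\|_1$ over the feasible set $\{z : \|D^{-r}(z-q)\|_\infty\leq\delta/2\}$ (possibly with additional feasible constraints satisfied by both $x$ and $\hat{x}$). Set $h=D_1^{\beta}(\hat{x}-x)$, indexed by $n\in\{0,\dots,N-1\}$, and let $t_n=n/N$, $S_M(j)=\{t_n : |t_n-\xi_j|\leq 0.16 M^{-1}\}$, and $S_M^c$ the set of grid points $t_n$ not in any $S_M(j)$. Then there is an absolute constant $C>0$ such that $\sum_{t_n\in S_M^c}|h_n|\leq C\sqrt{N}\,\|P_M h\|_2$. -/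

import Mathlib

open scoped BigOperators Classical
open Finset Matrix

/-- The `N × N` finite difference matrix with `1`s on the diagonal and `-1`s on
the subdiagonal. -/
noncomputable def Dmat (N : ℕ) : Matrix (Fin N) (Fin N) ℝ :=
  Matrix.of fun i j => if i = j then 1 else if (j : ℕ) + 1 = (i : ℕ) then -1 else 0

/-- The `N × N` circulant difference matrix: `Dmat` with an extra `-1` in the
upper-right corner. -/
noncomputable def D1mat (N : ℕ) : Matrix (Fin N) (Fin N) ℝ :=
  Matrix.of fun i j => if i = j then 1 else if ((j : ℕ) + 1) % N = (i : ℕ) then -1 else 0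

/-- Entrywise ℓ¹ norm of a vector. -/
noncomputable def l1 {N : ℕ} (v : Fin N → ℝ) : ℝ := ∑ i, |v i|

/-- Euclidean norm of a vector. -/
noncomputable def l2 {N : ℕ} (v : Fin N → ℝ) : ℝ := Real.sqrt (∑ i, (v i) ^ 2)

/-- Wrap-around distance on `{0, …, N-1}`. -/
def wrapDist (N : ℕ) (i j : Fin N) : ℕ :=
  min ((i : ℤ) - (j : ℤ)).natAbs (N - ((i : ℤ) - (j : ℤ)).natAbs)

/-- The `Λ_M` minimum separation condition for a vector `v ∈ ℝ^N`. -/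
def minSep (N M : ℕ) (v : Fin N → ℝ) : Prop :=
  ∀ i j : Fin N, v i ≠ 0 → v j ≠ 0 → i ≠ j →
    (2 : ℝ) / M ≤ (wrapDist N i j : ℝ) / N

/-- The projection `P_M = (1/N) F_M^* F_M` onto DFT frequencies `{-M, …, M}`. -/
noncomputable def Pproj (N M : ℕ) : Matrix (Fin N) (Fin N) ℝ :=
  Matrix.of fun m n => (1 / (N : ℝ)) *
    ∑ k ∈ Finset.Icc (-(M : ℤ)) (M : ℤ),
      Real.cos (2 * Real.pi * (k : ℝ) * (((m : ℕ) : ℝ) - ((n : ℕ) : ℝ)) / N)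


namespace SD
open Real

noncomputable def om (L : ℕ) (j : ℕ) : ℝ := π * (2 * j - L + 1) / L
noncomputable def dd (L : ℕ) (u : ℝ) : ℝ := L * sin (π * u / L)
noncomputable def S0 (L : ℕ) (u : ℝ) : ℝ := (1 / L : ℝ) * ∑ j ∈ range L, cos (om L j * u)
noncomputable def S1 (L : ℕ) (u : ℝ) : ℝ := (1 / L : ℝ) * ∑ j ∈ range L, -(om L j * sin (om L j * u))
noncomputable def S2 (L : ℕ) (u : ℝ) : ℝ :=
  (1 / L : ℝ) * ∑ j ∈ range L, -(om L j * (om L j * cos (om L j * u)))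
noncomputable def sg (L : ℕ) (u : ℝ) : ℝ := L / (2 * π) * sin (2 * π * u / L)
noncomputable def sg1 (L : ℕ) (u : ℝ) : ℝ := cos (2 * π * u / L)
noncomputable def sg2 (L : ℕ) (u : ℝ) : ℝ := -(2 * π / L * sin (2 * π * u / L))
noncomputable def G0 (L : ℕ) (a b u : ℝ) : ℝ := S0 L u ^ 4 * (a + b * sg L u)
noncomputable def J1 (L : ℕ) (u : ℝ) : ℝ := 4 * S0 L u ^ 3 * S1 L u
noncomputable def J2 (L : ℕ) (u : ℝ) : ℝ := 12 * S0 L u ^ 2 * S1 L u ^ 2 + 4 * S0 L u ^ 3 * S2 L u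
noncomputable def G1 (L : ℕ) (a b u : ℝ) : ℝ := J1 L u * (a + b * sg L u) + S0 L u ^ 4 * (b * sg1 L u)
noncomputable def G2 (L : ℕ) (a b u : ℝ) : ℝ :=
  J2 L u * (a + b * sg L u) + 2 * J1 L u * (b * sg1 L u) + S0 L u ^ 4 * (b * sg2 L u)

lemma hasDerivAt_S0 (L : ℕ) (u : ℝ) : HasDerivAt (S0 L) (S1 L u) u := by
  unfold S0 S1
  apply HasDerivAt.const_mul
  apply HasDerivAt.fun_sum
  intro j _
  have h : HasDerivAt (fun u : ℝ => om L j * u) (om L j) u := by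
    simpa using (hasDerivAt_id u).const_mul (om L j)
  exact h.cos.congr_deriv (by ring)

lemma hasDerivAt_S1 (L : ℕ) (u : ℝ) : HasDerivAt (S1 L) (S2 L u) u := by
  unfold S1 S2
  apply HasDerivAt.const_mul
  apply HasDerivAt.fun_sum
  intro j _
  have h : HasDerivAt (fun u : ℝ => om L j * u) (om L j) u := by
    simpa using (hasDerivAt_id u).const_mul (om L j)
  exact (h.sin.const_mul (om L j)).neg.congr_deriv (by ring)

lemma hasDerivAt_lin (c : ℝ) (L : ℕ) (u : ℝ) : HasDerivAt (fun u : ℝ => c * u / L) (c / L) u := by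
  simpa using ((hasDerivAt_id u).const_mul c).div_const (L : ℝ)

lemma hasDerivAt_sg (L : ℕ) (hL : 0 < L) (u : ℝ) : HasDerivAt (sg L) (sg1 L u) u := by
  unfold sg sg1
  have h := ((hasDerivAt_lin (2 * π) L u).sin).const_mul (L / (2 * π) : ℝ)
  refine h.congr_deriv ?_
  have : (L : ℝ) ≠ 0 := by positivity
  field_simp

lemma hasDerivAt_sg1 (L : ℕ) (u : ℝ) : HasDerivAt (sg1 L) (sg2 L u) u := by
  unfold sg1 sg2
  have h := ((hasDerivAt_lin (2 * π) L u).cos)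
  exact h.congr_deriv (by ring)

lemma hasDerivAt_J0 (L : ℕ) (u : ℝ) : HasDerivAt (fun u => S0 L u ^ 4) (J1 L u) u := by
  refine ((hasDerivAt_S0 L u).pow 4).congr_deriv ?_
  unfold J1; norm_num

lemma hasDerivAt_J1 (L : ℕ) (u : ℝ) : HasDerivAt (J1 L) (J2 L u) u := by
  unfold J1 J2
  refine ((((hasDerivAt_S0 L u).pow 3).const_mul 4).mul (hasDerivAt_S1 L u)).congr_deriv ?_
  simp; ring

lemma hasDerivAt_G0 (L : ℕ) (hL : 0 < L) (a b u : ℝ) : HasDerivAt (G0 L a b) (G1 L a b u) u := by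
  unfold G0 G1
  exact (hasDerivAt_J0 L u).mul (((hasDerivAt_sg L hL u).const_mul b).const_add a)

lemma hasDerivAt_G1 (L : ℕ) (hL : 0 < L) (a b u : ℝ) : HasDerivAt (G1 L a b) (G2 L a b u) u := by
  unfold G1 G2
  refine (((hasDerivAt_J1 L u).mul (((hasDerivAt_sg L hL u).const_mul b).const_add a)).add
    ((hasDerivAt_J0 L u).mul ((hasDerivAt_sg1 L u).const_mul b))).congr_deriv ?_
  ring

lemma dd_S0 (L : ℕ) (hL : 0 < L) (u : ℝ) : dd L u * S0 L u = sin (π * u) := by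
  have hL' : (L : ℝ) ≠ 0 := by positivity
  have key : ∀ n : ℕ, ∑ j ∈ range n, 2 * (cos (om L j * u) * sin (π * u / L))
      = sin (π * (2 * n - L) * u / L) + sin (π * u) := by
    intro n
    induction n with
    | zero =>
      have : π * (2 * ((0 : ℕ) : ℝ) - L) * u / L = -(π * u) := by push_cast; field_simp; ring
      rw [this, sin_neg]; simp
    | succ n ih =>
      rw [sum_range_succ, ih]
      have e1 : π * (2 * ((n + 1 : ℕ) : ℝ) - L) * u / L = om L n * u + π * u / L := by
        unfold om; push_cast; field_simp; ring
      have e2 : π * (2 * (n : ℝ) - L) * u / L = om L n * u - π * u / L := by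
        unfold om; field_simp; ring
      rw [e1, e2, sin_add, sin_sub]; ring
  have := key L
  have e : π * (2 * (L : ℝ) - L) * u / L = π * u := by field_simp; ring
  rw [e, ← mul_sum, ← sum_mul] at this
  unfold dd S0
  have e3 : (L : ℝ) * sin (π * u / L) * (1 / L * ∑ j ∈ range L, cos (om L j * u))
    = (∑ j ∈ range L, cos (om L j * u)) * sin (π * u / L) := by field_simp
  rw [e3]
  linarith

lemma hasDerivAt_dd (L : ℕ) (hL : 0 < L) (u : ℝ) : HasDerivAt (dd L) (π * cos (π * u / L)) u := by
  unfold dd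
  have h := ((hasDerivAt_lin π L u).sin).const_mul (L : ℝ)
  refine h.congr_deriv ?_
  have : (L : ℝ) ≠ 0 := by positivity
  field_simp

lemma hasDerivAt_sinpi (u : ℝ) : HasDerivAt (fun u => sin (π * u)) (π * cos (π * u)) u := by
  have h : HasDerivAt (fun u : ℝ => π * u) π u := by simpa using (hasDerivAt_id u).const_mul π
  exact h.sin.congr_deriv (by ring)
lemma hasDerivAt_cospi (u : ℝ) : HasDerivAt (fun u => π * cos (π * u)) (-(π ^ 2 * sin (π * u))) u := by
  have h : HasDerivAt (fun u : ℝ => π * u) π u := by simpa using (hasDerivAt_id u).const_mul π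
  exact ((h.cos).const_mul π).congr_deriv (by ring)

lemma dd_S1 (L : ℕ) (hL : 0 < L) (u : ℝ) :
    π * cos (π * u / L) * S0 L u + dd L u * S1 L u = π * cos (π * u) := by
  have h := (hasDerivAt_dd L hL u).mul (hasDerivAt_S0 L u)
  have h2 := hasDerivAt_sinpi u
  have : (dd L * S0 L) = fun u => sin (π * u) := by
    funext v; exact dd_S0 L hL v
  rw [this] at h
  exact h.unique h2

lemma dd_S2 (L : ℕ) (hL : 0 < L) (u : ℝ) :
    -(π ^ 2 / L ^ 2 * dd L u) * S0 L u + 2 * (π * cos (π * u / L)) * S1 L u + dd L u * S2 L u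
      = -(π ^ 2 * sin (π * u)) := by
  have hL' : (L : ℝ) ≠ 0 := by positivity
  have h0 := ((hasDerivAt_lin π L u).cos).const_mul π
  have h := (h0.mul (hasDerivAt_S0 L u)).add ((hasDerivAt_dd L hL u).mul (hasDerivAt_S1 L u))
  have h2 := hasDerivAt_cospi u
  have : ((fun u => π * cos (π * u / L)) * S0 L + dd L * S1 L) = fun u => π * cos (π * u) := by
    funext v; exact dd_S1 L hL v
  rw [this] at h
  have := h.unique h2
  rw [← this]
  unfold dd
  field_simp
  ring

/-- `E = 1/D`. -/
noncomputable def EE (L : ℕ) (u : ℝ) : ℝ := π / |dd L u|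

lemma pi4 : (97.4 : ℝ) ≤ π ^ 4 := by
  have h := pi_gt_d6
  have : (3.141592 : ℝ) ^ 4 ≤ π ^ 4 := by gcongr
  norm_num at this ⊢; linarith

lemma s3c (s c : ℝ) (h : s ^ 2 + c ^ 2 = 1) : |s ^ 3 * c| ≤ 0.325 := by
  apply abs_le_of_sq_le_sq _ (by norm_num)
  have hc : c ^ 2 = 1 - s ^ 2 := by linarith
  have : (s ^ 3 * c) ^ 2 = (s ^ 2) ^ 3 * (1 - s ^ 2) := by rw [← hc]; ring
  rw [this]
  set y := s ^ 2
  have hy : 0 ≤ y := sq_nonneg s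
  nlinarith [sq_nonneg (y - 3 / 4), sq_nonneg (y * (y - 3 / 4)), mul_nonneg hy (sq_nonneg (y - 3 / 4)), sq_nonneg ((y - 3/4) * (y + 1/2))]

lemma EE_nonneg (L : ℕ) (u : ℝ) : 0 ≤ EE L u := by unfold EE; positivity

lemma sg_EE (L : ℕ) (hL : 0 < L) (u : ℝ) (hd : dd L u ≠ 0) : |sg L u| * EE L u ≤ 1 := by
  have hL' : (L : ℝ) ≠ 0 := by positivity
  have : sg L u = (1 / π) * dd L u * cos (π * u / L) := by
    unfold sg dd
    have : 2 * π * u / L = 2 * (π * u / L) := by ring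
    rw [this, sin_two_mul]
    field_simp
  have hp := pi_pos
  have hd' : 0 < |dd L u| := abs_pos.mpr hd
  rw [this, abs_mul, abs_mul, abs_of_pos (by positivity : 0 < 1 / π)]
  unfold EE
  have := abs_cos_le_one (π * u / L)
  field_simp
  exact this

lemma env0 (L : ℕ) (hL : 0 < L) (u : ℝ) (hd : dd L u ≠ 0) :
    S0 L u ^ 4 ≤ EE L u ^ 4 / 97.4 := by
  have h0 := dd_S0 L hL u
  have hS : S0 L u = sin (π * u) / dd L u := by rw [← h0]; field_simp
  have hp := pi_pos
  have hE : EE L u ^ 4 = π ^ 4 / dd L u ^ 4 := by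
    unfold EE; rw [div_pow]; congr 1; rw [← abs_pow]; exact abs_of_nonneg (by positivity)
  rw [hS, hE, div_pow]
  have hs : sin (π * u) ^ 4 ≤ 1 := by
    have : sin (π * u) ^ 2 ≤ 1 := sin_sq_le_one _
    nlinarith [sq_nonneg (sin (π * u))]
  have : 0 < dd L u ^ 4 := by positivity
  rw [div_div, div_le_div_iff₀ this (by positivity)]
  nlinarith [pi4]

lemma d_inv (L : ℕ) (u : ℝ) (hd : dd L u ≠ 0) :
    ((dd L u)⁻¹) ^ 4 = EE L u ^ 4 / π ^ 4 := by
  have hp := pi_pos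
  have hE : EE L u ^ 4 = π ^ 4 / dd L u ^ 4 := by
    unfold EE; rw [div_pow]; congr 1; rw [← abs_pow]; exact abs_of_nonneg (by positivity)
  rw [hE]; field_simp

lemma e_le (L : ℕ) (u : ℝ) : |π * cos (π * u / L) * (dd L u)⁻¹| ≤ EE L u := by
  rw [abs_mul, abs_mul, abs_inv, abs_of_pos pi_pos]
  unfold EE
  rw [div_eq_mul_inv]
  have := abs_cos_le_one (π * u / L)
  have h2 : 0 ≤ |dd L u|⁻¹ := by positivity
  exact mul_le_mul_of_nonneg_right (mul_le_of_le_one_right pi_pos.le this) h2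

lemma env1 (L : ℕ) (hL : 0 < L) (u : ℝ) (hd : dd L u ≠ 0) :
    |J1 L u| ≤ EE L u ^ 4 * (4.09 + 4 * EE L u) / 97.4 := by
  have h0 := dd_S0 L hL u
  have h1 := dd_S1 L hL u
  have hel := e_le L u
  set s := sin (π * u) with hs
  set c := cos (π * u)
  set p := (dd L u)⁻¹ with hp
  set e := π * cos (π * u / L) * p with he
  have hdp : dd L u * p = 1 := mul_inv_cancel₀ hd
  have hS : S0 L u = s * p := by rw [← h0]; linear_combination (-S0 L u) * hdp
  have hS1 : S1 L u = p * (π * c - e * s) := by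
    rw [← h1, ← h0]
    linear_combination (-S1 L u + e * S0 L u) * hdp + (S0 L u) * he
  have hJ : J1 L u = p ^ 4 * (4 * π * (s ^ 3 * c) - 4 * s ^ 4 * e) := by
    unfold J1; rw [hS, hS1]; ring
  rw [hJ, abs_mul, abs_of_nonneg (by positivity), d_inv L u hd]
  have hsc : s ^ 2 + c ^ 2 = 1 := sin_sq_add_cos_sq _
  have h3 := s3c s c hsc
  have hs4 : s ^ 4 ≤ 1 := by nlinarith [sq_nonneg s, sq_nonneg c]
  have hE0 := EE_nonneg L u
  have hb : |4 * π * (s ^ 3 * c) - 4 * s ^ 4 * e| ≤ 4.09 + 4 * EE L u := by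
    calc _ ≤ |4 * π * (s ^ 3 * c)| + |4 * s ^ 4 * e| := abs_sub _ _
      _ = 4 * π * |s ^ 3 * c| + 4 * s ^ 4 * |e| := by
        rw [abs_mul, abs_mul (4 * s ^ 4), abs_of_pos (by positivity : 0 < 4 * π),
          abs_of_nonneg (by positivity : 0 ≤ 4 * s ^ 4)]
      _ ≤ 4 * 3.1416 * 0.325 + 4 * 1 * EE L u := by
        have := pi_lt_d4
        gcongr
      _ ≤ _ := by norm_num
  have h4 := pi4
  calc _ ≤ EE L u ^ 4 / 97.4 * (4.09 + 4 * EE L u) := by gcongr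
    _ = _ := by ring

set_option maxHeartbeats 1000000 in
lemma env2 (L : ℕ) (hL : 64 ≤ L) (u : ℝ) (hd : dd L u ≠ 0) :
    |J2 L u| ≤ EE L u ^ 4 * (39.5 + 32.7 * EE L u + 20 * EE L u ^ 2) / 97.4 := by
  have hL0 : 0 < L := by omega
  have hL' : (64 : ℝ) ≤ L := by exact_mod_cast hL
  have h0 := dd_S0 L hL0 u
  have h1 := dd_S1 L hL0 u
  have h2 := dd_S2 L hL0 u
  have hel := e_le L u
  set s := sin (π * u) with hs
  set c := cos (π * u)
  set p := (dd L u)⁻¹ with hp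
  set q := π ^ 2 / (L : ℝ) ^ 2 with hq
  set e := π * cos (π * u / L) * p with he
  have hdp : dd L u * p = 1 := mul_inv_cancel₀ hd
  have hS : S0 L u = s * p := by rw [← h0]; linear_combination (-S0 L u) * hdp
  have hS1 : S1 L u = p * (π * c - e * s) := by
    rw [← h1, ← h0]
    linear_combination (-S1 L u + e * S0 L u) * hdp + (S0 L u) * he
  have hS2 : S2 L u = p * (-(π ^ 2 * s) - 2 * e * (π * c - e * s) + q * s) := by
    have : S2 L u = p * (-(π ^ 2 * s)) - 2 * e * S1 L u + q * s * p := by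
      rw [← h2, ← h0]
      linear_combination (-S2 L u) * hdp + 2 * S1 L u * (-he)
    rw [this, hS1]; ring
  have hJ : J2 L u = p ^ 4 * (4 * π ^ 2 * (s ^ 2 * (3 * c ^ 2 - s ^ 2)) - 32 * π * (s ^ 3 * c) * e
      + 20 * s ^ 4 * e ^ 2 + 4 * q * s ^ 4) := by
    unfold J2; rw [hS, hS1, hS2]; ring
  rw [hJ, abs_mul, abs_of_nonneg (by positivity : 0 ≤ p ^ 4), d_inv L u hd]
  have hsc : s ^ 2 + c ^ 2 = 1 := sin_sq_add_cos_sq _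
  have h3 := s3c s c hsc
  have hs4 : s ^ 4 ≤ 1 := by nlinarith [sq_nonneg s, sq_nonneg c]
  have hE0 := EE_nonneg L u
  have hq0 : q ≤ 0.0025 := by
    rw [hq, div_le_iff₀ (by positivity)]
    have := pi_lt_d4
    nlinarith [pi_pos]
  have hq1 : 0 ≤ q := by positivity
  have hss : |s ^ 2 * (3 * c ^ 2 - s ^ 2)| ≤ 1 := by
    have : c ^ 2 = 1 - s ^ 2 := by linarith
    rw [this, abs_le]
    have := sq_nonneg c
    constructor <;> nlinarith [sq_nonneg s, sq_nonneg (s ^ 2 - 3 / 8)]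
  have he2 : e ^ 2 ≤ EE L u ^ 2 := by rw [← sq_abs e]; gcongr
  have hb : |4 * π ^ 2 * (s ^ 2 * (3 * c ^ 2 - s ^ 2)) - 32 * π * (s ^ 3 * c) * e
      + 20 * s ^ 4 * e ^ 2 + 4 * q * s ^ 4| ≤ 39.5 + 32.7 * EE L u + 20 * EE L u ^ 2 := by
    calc _ ≤ |4 * π ^ 2 * (s ^ 2 * (3 * c ^ 2 - s ^ 2))| + |32 * π * (s ^ 3 * c) * e|
          + |20 * s ^ 4 * e ^ 2| + |4 * q * s ^ 4| := by
          refine (abs_add_le _ _).trans ?_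
          gcongr
          refine (abs_add_le _ _).trans ?_
          gcongr
          exact abs_sub _ _
      _ = 4 * π ^ 2 * |s ^ 2 * (3 * c ^ 2 - s ^ 2)| + 32 * π * |s ^ 3 * c| * |e|
          + 20 * s ^ 4 * e ^ 2 + 4 * q * s ^ 4 := by
        rw [abs_mul (4 * π ^ 2), abs_mul _ e, abs_mul (32 * π),
          abs_of_pos (by positivity : 0 < 4 * π ^ 2), abs_of_pos (by positivity : 0 < 32 * π),
          abs_of_nonneg (by positivity : 0 ≤ 20 * s ^ 4 * e ^ 2),
          abs_of_nonneg (by positivity : 0 ≤ 4 * q * s ^ 4)]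
      _ ≤ 4 * 3.1416 ^ 2 * 1 + 32 * 3.1416 * 0.325 * EE L u + 20 * 1 * EE L u ^ 2
          + 4 * 0.0025 * 1 := by
        have := pi_lt_d4
        gcongr
      _ ≤ _ := by linarith
  have h4 := pi4
  calc _ ≤ EE L u ^ 4 / 97.4 * (39.5 + 32.7 * EE L u + 20 * EE L u ^ 2) := by gcongr
    _ = _ := by ring
end SD

namespace SD
open Real

lemma cos_le4 (x : ℝ) (hx : |x| ≤ 2) : cos x ≤ 1 - x ^ 2 / 2 + x ^ 4 / 24 := by
  wlog h : 0 ≤ x generalizing x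
  · have := this (-x) (by rwa [abs_neg]) (by linarith)
    rw [cos_neg] at this
    convert this using 2 <;> ring
  rw [abs_of_nonneg h] at hx
  have h1 := sin_ge_sub_cube (x := x / 2) (by linarith)
  set y := x / 2 with hy
  have hxy : x = 2 * y := by linarith
  have hy1 : y ≤ 1 := by linarith
  have hy0 : 0 ≤ y := by linarith
  have h2 : cos x = 1 - 2 * sin y ^ 2 := by
    rw [hxy, cos_two_mul, sin_sq]; ring
  have h3 : 0 ≤ y - y ^ 3 / 6 := by nlinarith [mul_nonneg hy0 (sub_nonneg.mpr hy1), mul_nonneg hy0 hy0]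
  have h4 : (y - y ^ 3 / 6) ^ 2 ≤ sin y ^ 2 := by gcongr
  rw [h2, hxy]
  nlinarith [sq_nonneg (y ^ 3)]

lemma mom2 (c : ℝ) (n : ℕ) : ∑ j ∈ range n, (2 * (j : ℝ) + c) ^ 2
    = 2 * n * (n - 1) * (2 * n - 1) / 3 + 2 * c * n * (n - 1) + c ^ 2 * n := by
  induction n with
  | zero => simp
  | succ n ih => rw [sum_range_succ, ih]; push_cast; ring

lemma mom4 (c : ℝ) (n : ℕ) : ∑ j ∈ range n, (2 * (j : ℝ) + c) ^ 4
    = 8 * n * (n - 1) * (2 * n - 1) * (3 * n ^ 2 - 3 * n - 1) / 15 + 8 * c * (n * (n - 1)) ^ 2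
      + 4 * c ^ 2 * n * (n - 1) * (2 * n - 1) + 4 * c ^ 3 * n * (n - 1) + c ^ 4 * n := by
  induction n with
  | zero => simp
  | succ n ih => rw [sum_range_succ, ih]; push_cast; ring

lemma om2 (L : ℕ) (hL : 0 < L) : (1 / L : ℝ) * ∑ j ∈ range L, om L j ^ 2 = π ^ 2 / 3 * (1 - 1 / L ^ 2) := by
  have hL' : (L : ℝ) ≠ 0 := by positivity
  have : ∀ j ∈ range L, om L j ^ 2 = (π / L) ^ 2 * (2 * (j : ℝ) + (1 - L)) ^ 2 := by
    intro j _; unfold om; field_simp; ring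
  rw [sum_congr rfl this, ← mul_sum, mom2]
  field_simp; ring

lemma om4 (L : ℕ) (hL : 0 < L) : (1 / L : ℝ) * ∑ j ∈ range L, om L j ^ 4 ≤ π ^ 4 / 5 := by
  have hL' : (1 : ℝ) ≤ L := by exact_mod_cast hL
  have hL'' : (L : ℝ) ≠ 0 := by positivity
  have : ∀ j ∈ range L, om L j ^ 4 = (π / L) ^ 4 * (2 * (j : ℝ) + (1 - L)) ^ 4 := by
    intro j _; unfold om; field_simp; ring
  rw [sum_congr rfl this, ← mul_sum, mom4]
  have : (1 / L : ℝ) * ((π / L) ^ 4 * (8 * L * (L - 1) * (2 * L - 1) * (3 * L ^ 2 - 3 * L - 1) / 15 + 8 * (1 - L) * (L * (L - 1)) ^ 2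
      + 4 * (1 - L) ^ 2 * L * (L - 1) * (2 * L - 1) + 4 * (1 - L) ^ 3 * L * (L - 1) + (1 - L) ^ 4 * L))
      = π ^ 4 / 5 - π ^ 4 / 15 * ((10 * L ^ 2 - 7) / L ^ 4) := by
    field_simp; ring
  rw [this]
  have : 0 ≤ π ^ 4 / 15 * ((10 * (L : ℝ) ^ 2 - 7) / L ^ 4) := by
    have : 0 ≤ 10 * (L : ℝ) ^ 2 - 7 := by nlinarith
    positivity
  linarith

lemma om_abs (L : ℕ) (j : ℕ) (hj : j < L) : |om L j| ≤ π := by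
  have hL : 0 < L := by omega
  have hL' : (0 : ℝ) < L := by positivity
  have hj' : (j : ℝ) + 1 ≤ L := by exact_mod_cast hj
  have hj0 : (0 : ℝ) ≤ j := by positivity
  unfold om
  rw [abs_div, abs_mul, abs_of_pos pi_pos, abs_of_pos hL', div_le_iff₀ hL']
  have : |2 * (j : ℝ) - L + 1| ≤ L := by rw [abs_le]; constructor <;> linarith
  nlinarith [pi_pos]

lemma pi2a : (9.8696 : ℝ) ≤ π ^ 2 := by
  have h := pi_gt_d6
  nlinarith
lemma pi2b : π ^ 2 ≤ (9.8697 : ℝ) := by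
  have h := pi_lt_d6
  nlinarith [pi_pos]

lemma S0_lower (L : ℕ) (hL : 0 < L) (u : ℝ) : 1 - 1.645 * u ^ 2 ≤ S0 L u := by
  have hL' : (0 : ℝ) < L := by positivity
  have h1 : (1 / L : ℝ) * ∑ j ∈ range L, (1 - u ^ 2 / 2 * om L j ^ 2) ≤ S0 L u := by
    unfold S0
    gcongr with j hj
    have := one_sub_sq_div_two_le_cos (x := om L j * u)
    nlinarith
  rw [sum_sub_distrib, ← mul_sum] at h1
  have h2 := om2 L hL
  simp only [sum_const, card_range, nsmul_eq_mul, mul_one] at h1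
  have h3 : (1 / L : ℝ) * (L - u ^ 2 / 2 * ∑ j ∈ range L, om L j ^ 2)
      = 1 - u ^ 2 / 2 * ((1 / L : ℝ) * ∑ j ∈ range L, om L j ^ 2) := by field_simp
  rw [h3, h2] at h1
  have h4 : π ^ 2 / 3 * (1 - 1 / (L : ℝ) ^ 2) ≤ 3.29 := by
    have : 0 ≤ 1 / (L : ℝ) ^ 2 := by positivity
    nlinarith [pi2b, sq_nonneg π]
  nlinarith [sq_nonneg u]

lemma S0_upper (L : ℕ) (hL : 64 ≤ L) (u : ℝ) (hu : |u| ≤ 0.6) :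
    S0 L u ≤ 1 - 1.6445 * u ^ 2 + 0.812 * u ^ 4 := by
  have hL0 : 0 < L := by omega
  have hL' : (0 : ℝ) < L := by positivity
  have hL64 : (64 : ℝ) ≤ L := by exact_mod_cast hL
  have h1 : S0 L u ≤ (1 / L : ℝ) * ∑ j ∈ range L, (1 - u ^ 2 / 2 * om L j ^ 2 + u ^ 4 / 24 * om L j ^ 4) := by
    unfold S0
    gcongr with j hj
    have h := cos_le4 (om L j * u) (by
      rw [abs_mul]
      have h1 := om_abs L j (mem_range.mp hj)
      have := pi_lt_d4
      calc _ ≤ π * 0.6 := by gcongr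
        _ ≤ _ := by linarith)
    nlinarith
  rw [sum_add_distrib, sum_sub_distrib, ← mul_sum, ← mul_sum] at h1
  have h2 := om2 L hL0
  have h2' := om4 L hL0
  simp only [sum_const, card_range, nsmul_eq_mul, mul_one] at h1
  have h3 : (1 / L : ℝ) * (L - u ^ 2 / 2 * ∑ j ∈ range L, om L j ^ 2 + u ^ 4 / 24 * ∑ j ∈ range L, om L j ^ 4)
      = 1 - u ^ 2 / 2 * ((1 / L : ℝ) * ∑ j ∈ range L, om L j ^ 2)
        + u ^ 4 / 24 * ((1 / L : ℝ) * ∑ j ∈ range L, om L j ^ 4) := by field_simp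
  rw [h3, h2] at h1
  have h4 : 3.289 ≤ π ^ 2 / 3 * (1 - 1 / (L : ℝ) ^ 2) := by
    have : 1 / (L : ℝ) ^ 2 ≤ 1 / 64 ^ 2 := by gcongr
    nlinarith [pi2a, sq_nonneg π]
  have h5 : π ^ 4 ≤ 97.44 := by
    have : π ^ 4 = (π ^ 2) ^ 2 := by ring
    nlinarith [pi2b, sq_nonneg π]
  have h6 : u ^ 4 / 24 * ((1 / L : ℝ) * ∑ j ∈ range L, om L j ^ 4) ≤ u ^ 4 / 24 * (97.44 / 5) := by
    gcongr
    linarith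
  nlinarith [sq_nonneg u, mul_le_mul_of_nonneg_left h4 (sq_nonneg u)]

/-- wrap-around norm with period `L`. -/
noncomputable def rho (L : ℕ) (x : ℝ) : ℝ := |x - round (x / L) * L|

lemma rho_le (L : ℕ) (hL : 0 < L) (x : ℝ) (z : ℤ) : rho L x ≤ |x - z * L| := by
  have hL' : (0 : ℝ) < L := by positivity
  have h := round_le (x / L) z
  unfold rho
  have e : ∀ w : ℝ, |x - w * L| = |x / L - w| * L := by
    intro w
    rw [← abs_of_pos hL', ← abs_mul, abs_of_pos hL']; congr 1; field_simp
  rw [e, e]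
  gcongr

lemma rho_half (L : ℕ) (hL : 0 < L) (x : ℝ) : rho L x ≤ L / 2 := by
  have hL' : (0 : ℝ) < L := by positivity
  have h := abs_sub_round (x / L)
  unfold rho
  have e : ∀ w : ℝ, |x - w * L| = |x / L - w| * L := by
    intro w
    rw [← abs_of_pos hL', ← abs_mul, abs_of_pos hL']; congr 1; field_simp
  rw [e]
  nlinarith

lemma rho_add (L : ℕ) (hL : 0 < L) (x y : ℝ) : rho L (x + y) ≤ rho L x + rho L y := by
  refine (rho_le L hL (x + y) (round (x / L) + round (y / L))).trans ?_
  unfold rho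
  push_cast
  refine le_trans (le_of_eq ?_) (abs_add_le _ _)
  congr 1; ring

lemma rho_neg (L : ℕ) (hL : 0 < L) (x : ℝ) : rho L (-x) = rho L x := by
  have key : ∀ y, rho L (-y) ≤ rho L y := by
    intro y
    refine (rho_le L hL (-y) (-round (y / L))).trans (le_of_eq ?_)
    unfold rho
    rw [← abs_neg]; congr 1; push_cast; ring
  exact le_antisymm (key x) (by simpa using key (-x))

lemma abs_dd (L : ℕ) (hL : 0 < L) (u : ℝ) : |dd L u| = L * sin (π * rho L u / L) := by
  have hL' : (0 : ℝ) < L := by positivity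
  set z := round (u / L) with hz
  set w := u - z * L with hw
  have hr : rho L u = |w| := rfl
  have hh := rho_half L hL u
  have e1 : π * u / L = π * w / L + z * π := by rw [hw]; field_simp; ring
  have e2 : |sin (π * u / L)| = |sin (π * w / L)| := by
    rw [e1, sin_add_int_mul_pi, abs_mul]; simp [abs_zpow]
  have e3 : |sin (π * w / L)| = sin (π * |w| / L) := by
    have hpos : 0 ≤ sin (π * |w| / L) := by
      apply sin_nonneg_of_nonneg_of_le_pi (by positivity)
      rw [div_le_iff₀ hL']
      rw [hr] at hh
      nlinarith [pi_pos]
    rcases le_total 0 w with h | h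
    · rw [abs_of_nonneg h] at hpos ⊢; exact abs_of_nonneg hpos
    · rw [abs_of_nonpos h] at hpos ⊢
      rw [← abs_neg, ← sin_neg]
      rw [show -(π * w / L) = π * -w / L by ring]; exact abs_of_nonneg hpos
  unfold dd
  rw [abs_mul, abs_of_pos hL', e2, e3, hr]

lemma EE_rho (L : ℕ) (hL : 0 < L) (u : ℝ) (h : 0 < rho L u) :
    dd L u ≠ 0 ∧ EE L u ≤ 1 / rho L u * (1 + 2.8 * (rho L u ^ 2 / L ^ 2)) := by
  have hL' : (0 : ℝ) < L := by positivity
  have hh := rho_half L hL u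
  have hd := abs_dd L hL u
  unfold EE
  rw [← abs_pos, hd]
  set r := rho L u
  set y := r ^ 2 / (L : ℝ) ^ 2 with hy
  have hy0 : 0 ≤ y := by positivity
  have hy1 : y ≤ 1 / 4 := by
    rw [hy, div_le_iff₀ (by positivity)]; nlinarith
  have hs := sin_ge_sub_cube (x := π * r / L) (by positivity)
  have e : L * (π * r / L - (π * r / L) ^ 3 / 6) = π * r * (1 - π ^ 2 * y / 6) := by
    rw [hy]; field_simp
  have hpy : π ^ 2 * y / 6 ≤ 0.41124 := by nlinarith [pi2b]
  have hpy0 : 0 ≤ π ^ 2 * y / 6 := by positivity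
  have h1 : π * r * (1 - π ^ 2 * y / 6) ≤ L * sin (π * r / L) := by
    rw [← e]; gcongr
  have hpos : 0 < π * r * (1 - π ^ 2 * y / 6) := by
    have := pi_pos
    have : 0 < 1 - π ^ 2 * y / 6 := by linarith
    positivity
  refine ⟨by linarith, ?_⟩
  calc π / (L * sin (π * r / L)) ≤ π / (π * r * (1 - π ^ 2 * y / 6)) := by
        have := pi_pos
        gcongr
    _ = 1 / r * (1 / (1 - π ^ 2 * y / 6)) := by
        have : 1 - π ^ 2 * y / 6 ≠ 0 := by linarith
        have := pi_pos.ne'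
        field_simp
    _ ≤ 1 / r * (1 + 2.8 * y) := by
        gcongr
        rw [div_le_iff₀ (by linarith)]
        have : 1.7 * (π ^ 2 * y / 6) ≤ 2.8 * y := by nlinarith [pi2b]
        nlinarith

lemma EE_bds (L : ℕ) (hL : 64 ≤ L) (u r : ℝ) (hr : 0 < r) (h : r ≤ rho L u) :
    dd L u ≠ 0 ∧ EE L u ≤ 1 / r + 0.022 ∧ EE L u ^ 4 ≤ (1 / r) ^ 4 + 0.0072 * (1 / r) ^ 2 ∧
      EE L u ^ 3 ≤ (1 / r) ^ 3 + 0.123 * (1 / r) ^ 2 := by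
  have hL0 : 0 < L := by omega
  have hL' : (0 : ℝ) < L := by positivity
  have hL64 : (64 : ℝ) ≤ L := by exact_mod_cast hL
  have hh := rho_half L hL0 u
  have hp : 0 < rho L u := by linarith
  obtain ⟨hd, hE⟩ := EE_rho L hL0 u hp
  have hE0 := EE_nonneg L u
  have hx : 1 / rho L u ≤ 1 / r := by gcongr
  set R := rho L u
  set x := 1 / R with hxR
  have hx0 : 0 < x := by positivity
  set y := R ^ 2 / (L : ℝ) ^ 2 with hy
  have hy0 : 0 ≤ y := by positivity
  have hy1 : y ≤ 1 / 4 := by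
    rw [hy, div_le_iff₀ (by positivity)]; nlinarith
  have hxR1 : x * R = 1 := by rw [hxR]; field_simp
  -- y x ≤ 1/128, y x² ≤ 1/4096
  have hyx2 : y * x ^ 2 ≤ 1 / 4096 := by
    have : y * x ^ 2 = 1 / L ^ 2 := by rw [hy, hxR]; field_simp
    rw [this]
    have : (1 : ℝ) / L ^ 2 ≤ 1 / 64 ^ 2 := by gcongr
    norm_num at this ⊢; exact this
  have hyx : y * x ≤ 1 / 128 := by
    have : y * x = R / L / L := by rw [hy, hxR]; field_simp
    rw [this, div_div, div_le_iff₀ (by positivity)]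
    nlinarith
  have p4 : (1 + 2.8 * y) ^ 4 ≤ 1 + 29.49 * y := by
    have h2 : y ^ 2 ≤ y / 4 := by nlinarith
    have h3 : y ^ 3 ≤ y / 16 := by nlinarith
    have h4 : y ^ 4 ≤ y / 64 := by nlinarith
    nlinarith
  have p3 : (1 + 2.8 * y) ^ 3 ≤ 1 + 15.7 * y := by
    have h2 : y ^ 2 ≤ y / 4 := by nlinarith
    have h3 : y ^ 3 ≤ y / 16 := by nlinarith
    nlinarith
  refine ⟨hd, ?_, ?_, ?_⟩
  · have : x * (1 + 2.8 * y) ≤ x + 0.022 := by nlinarith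
    linarith
  · calc EE L u ^ 4 ≤ (x * (1 + 2.8 * y)) ^ 4 := by gcongr
      _ = x ^ 4 * (1 + 2.8 * y) ^ 4 := by ring
      _ ≤ x ^ 4 * (1 + 29.49 * y) := by gcongr
      _ = x ^ 4 + 29.49 * (y * x ^ 2) * x ^ 2 := by ring
      _ ≤ x ^ 4 + 29.49 * (1 / 4096) * x ^ 2 := by gcongr
      _ ≤ x ^ 4 + 0.0072 * x ^ 2 := by nlinarith [sq_nonneg x]
      _ ≤ _ := by gcongr
  · calc EE L u ^ 3 ≤ (x * (1 + 2.8 * y)) ^ 3 := by gcongr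
      _ = x ^ 3 * (1 + 2.8 * y) ^ 3 := by ring
      _ ≤ x ^ 3 * (1 + 15.7 * y) := by gcongr
      _ = x ^ 3 + 15.7 * (y * x) * x ^ 2 := by ring
      _ ≤ x ^ 3 + 15.7 * (1 / 128) * x ^ 2 := by gcongr
      _ ≤ x ^ 3 + 0.123 * x ^ 2 := by nlinarith [sq_nonneg x]
      _ ≤ _ := by gcongr

end SD

namespace SD
open Real

lemma sum_bins {ι : Type*} [Fintype ι] (L : ℕ) (hL : 0 < L) (y : ι → ℝ)
    (hsep : ∀ i j, i ≠ j → 1 ≤ rho L (y i - y j)) (i : ι) (F : ι → ℝ) (q : ℕ → ℝ) (Q : ℝ)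
    (hq0 : ∀ k, 0 ≤ q k) (hF : ∀ j, j ≠ i → F j ≤ q ⌊rho L (y j - y i)⌋₊)
    (hQ : ∀ K : ℕ, ∑ k ∈ Icc 1 K, q k ≤ Q) :
    ∑ j ∈ univ.erase i, F j ≤ 2 * Q := by
  set w : ι → ℝ := fun j => (y j - y i) - round ((y j - y i) / L) * L with hw
  have hwr : ∀ j, rho L (y j - y i) = |w j| := fun j => rfl
  have main : ∀ A : Finset ι, (∀ j ∈ A, j ≠ i) →
      (∀ j ∈ A, ∀ l ∈ A, |w j| - |w l| = w j - w l ∨ |w j| - |w l| = -(w j - w l)) →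
      ∑ j ∈ A, F j ≤ Q := by
    intro A hA hs
    have hinj : Set.InjOn (fun j => ⌊rho L (y j - y i)⌋₊) A := by
      intro j hj l hl hjl
      by_contra hne
      have h1 := hsep j l hne
      have h2 : rho L (y j - y l) ≤ |w j - w l| := by
        refine (rho_le L hL (y j - y l) (round ((y j - y i) / L) - round ((y l - y i) / L))).trans
          (le_of_eq ?_)
        simp only [hw]; congr 1; push_cast; ring
      simp only [hwr] at hjl
      have a1 := Nat.floor_le (abs_nonneg (w j))
      have a2 := Nat.lt_floor_add_one |w j|
      have b1 := Nat.floor_le (abs_nonneg (w l))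
      have b2 := Nat.lt_floor_add_one |w l|
      rw [hjl] at a1 a2
      have : |w j - w l| < 1 := by
        rw [abs_lt]
        rcases hs j hj l hl with h | h <;> constructor <;> linarith
      linarith
    calc ∑ j ∈ A, F j ≤ ∑ j ∈ A, q ⌊rho L (y j - y i)⌋₊ := sum_le_sum fun j hj => hF j (hA j hj)
      _ = ∑ k ∈ A.image (fun j => ⌊rho L (y j - y i)⌋₊), q k := (sum_image hinj).symm
      _ ≤ ∑ k ∈ Icc 1 ((A.image (fun j => ⌊rho L (y j - y i)⌋₊)).sup id), q k := by
        apply sum_le_sum_of_subset_of_nonneg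
        · intro k hk
          rw [mem_Icc]
          refine ⟨?_, le_sup (f := id) hk⟩
          obtain ⟨j, hj, rfl⟩ := mem_image.mp hk
          rw [Nat.one_le_floor_iff]
          exact hsep j i (hA j hj)
        · intro k _ _; exact hq0 k
      _ ≤ Q := hQ _
  rw [← sum_filter_add_sum_filter_not (univ.erase i) (fun j => 0 ≤ w j)]
  have m1 := main ((univ.erase i).filter (fun j => 0 ≤ w j))
    (fun j hj => (mem_erase.mp (mem_filter.mp hj).1).1)
    (fun j hj l hl => by
      left; rw [abs_of_nonneg (mem_filter.mp hj).2, abs_of_nonneg (mem_filter.mp hl).2])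
  have m2 := main ((univ.erase i).filter (fun j => ¬ 0 ≤ w j))
    (fun j hj => (mem_erase.mp (mem_filter.mp hj).1).1)
    (fun j hj l hl => by
      right
      have h1 := (mem_filter.mp hj).2
      have h2 := (mem_filter.mp hl).2
      rw [abs_of_neg (not_le.mp h1), abs_of_neg (not_le.mp h2)]; ring)
  linarith

lemma sum_tail (q : ℕ → ℝ) (v A B : ℝ) (hv : v ≤ 1 / 2) (hA : 0 ≤ A) (hB : 0 ≤ B) (h1 : q 1 ≤ B)
    (h2 : ∀ k : ℕ, 2 ≤ k → q k ≤ A * (1 / (k - v)) ^ 2) (K : ℕ) :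
    ∑ k ∈ Icc 1 K, q k ≤ B + A / (1.5 - v) := by
  have key : ∀ n : ℕ, ∑ k ∈ Icc 1 (n + 1), q k ≤ B + A * (1 / (1.5 - v) - 1 / (n + 1.5 - v)) := by
    intro n
    induction n with
    | zero => simpa using h1
    | succ n ih =>
      rw [sum_Icc_succ_top (by omega)]
      have h := h2 (n + 1 + 1) (by omega)
      have hn : (0 : ℝ) ≤ n := by positivity
      have e : (1 / (((n + 1 + 1 : ℕ) : ℝ) - v)) ^ 2 ≤ 1 / (n + 1.5 - v) - 1 / ((n + 1 : ℕ) + 1.5 - v) := by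
        push_cast
        have p1 : 0 < (n : ℝ) + 1.5 - v := by linarith
        have p2 : 0 < (n : ℝ) + 1 + 1.5 - v := by linarith
        have p3 : 0 < (n : ℝ) + 1 + 1 - v := by linarith
        rw [div_sub_div _ _ p1.ne' p2.ne', one_div, inv_pow, ← one_div,
          div_le_div_iff₀ (by positivity) (by positivity)]
        nlinarith
      have := mul_le_mul_of_nonneg_left e hA
      linarith
  cases K with
  | zero => simp; have : 0 < 1.5 - v := by linarith
            positivity
  | succ n =>
    refine (key n).trans ?_
    have hn : (0 : ℝ) ≤ n := by positivity
    have : 0 < (n : ℝ) + 1.5 - v := by linarith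
    have : 0 ≤ A * (1 / (n + 1.5 - v)) := by positivity
    rw [mul_sub, mul_one_div]; linarith

noncomputable def Q4 (v : ℝ) : ℝ :=
  (1 / (1 - v)) ^ 4 + 0.0072 * (1 / (1 - v)) ^ 2 + ((1 / (2 - v)) ^ 2 + 0.0072) / (1.5 - v)
noncomputable def Q3 (v : ℝ) : ℝ :=
  (1 / (1 - v)) ^ 3 + 0.123 * (1 / (1 - v)) ^ 2 + (1 / (2 - v) + 0.123) / (1.5 - v)

lemma sums_v {ι : Type*} [Fintype ι] (L : ℕ) (hL : 64 ≤ L) (y : ι → ℝ)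
    (hsep : ∀ i j, i ≠ j → 1 ≤ rho L (y i - y j)) (i : ι) (t v : ℝ) (hv0 : 0 ≤ v) (hv : v ≤ 1 / 2)
    (ht : rho L (t - y i) ≤ v) :
    (∀ j, j ≠ i → 1 - v ≤ rho L (t - y j)) ∧
    ∑ j ∈ univ.erase i, EE L (t - y j) ^ 4 ≤ 2 * Q4 v ∧
    ∑ j ∈ univ.erase i, EE L (t - y j) ^ 3 ≤ 2 * Q3 v := by
  have hL0 : 0 < L := by omega
  have htri : ∀ j, rho L (y j - y i) - v ≤ rho L (t - y j) := by
    intro j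
    have h := rho_add L hL0 (y j - t) (t - y i)
    have h2 := rho_neg L hL0 (t - y j)
    rw [neg_sub] at h2
    rw [h2] at h
    have e : y j - t + (t - y i) = y j - y i := by ring
    rw [e] at h
    linarith
  have hk : ∀ j, j ≠ i → 1 ≤ ⌊rho L (y j - y i)⌋₊ := by
    intro j hj; rw [Nat.one_le_floor_iff]; exact hsep j i hj
  have hfl : ∀ j, (⌊rho L (y j - y i)⌋₊ : ℝ) - v ≤ rho L (t - y j) := by
    intro j
    have := Nat.floor_le (a := rho L (y j - y i)) (abs_nonneg _)
    linarith [htri j]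
  have hE : ∀ j, j ≠ i → _ := fun j hj => EE_bds L hL (t - y j) (⌊rho L (y j - y i)⌋₊ - v) (by
    have : (1 : ℝ) ≤ ⌊rho L (y j - y i)⌋₊ := by exact_mod_cast hk j hj
    linarith) (hfl j)
  have hinv : ∀ k : ℕ, 2 ≤ k → 0 < 1 / ((k : ℝ) - v) ∧ 1 / ((k : ℝ) - v) ≤ 1 / (2 - v) := by
    intro k hk
    have : (2 : ℝ) ≤ k := by exact_mod_cast hk
    have p : 0 < 2 - v := by linarith
    constructor
    · have : 0 < (k : ℝ) - v := by linarith
      positivity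
    · gcongr
  have p1 : 0 < 1 - v := by linarith
  have p2 : 0 < 2 - v := by linarith
  refine ⟨fun j hj => by linarith [htri j, hsep j i hj], ?_, ?_⟩
  · apply sum_bins L hL0 y hsep i _
      (fun k => if k = 0 then 0 else (1 / ((k : ℝ) - v)) ^ 4 + 0.0072 * (1 / ((k : ℝ) - v)) ^ 2) _
    · intro k; split_ifs
      · exact le_rfl
      · positivity
    · intro j hj
      have := hk j hj
      rw [if_neg (by omega)]
      exact (hE j hj).2.2.1
    · intro K
      apply sum_tail _ v _ _ hv (by positivity) (by positivity)
      · simp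
      · intro k hk
        rw [if_neg (by omega)]
        obtain ⟨h1, h2⟩ := hinv k hk
        have : (1 / ((k : ℝ) - v)) ^ 2 ≤ (1 / (2 - v)) ^ 2 := by gcongr
        nlinarith [sq_nonneg (1 / ((k : ℝ) - v))]
  · apply sum_bins L hL0 y hsep i _
      (fun k => if k = 0 then 0 else |(1 / ((k : ℝ) - v)) ^ 3 + 0.123 * (1 / ((k : ℝ) - v)) ^ 2|) _
    · intro k; split_ifs
      · exact le_rfl
      · positivity
    · intro j hj
      have := hk j hj
      rw [if_neg (by omega)]
      exact (hE j hj).2.2.2.trans (le_abs_self _)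
    · intro K
      apply sum_tail _ v _ _ hv (by positivity) (by positivity)
      · simp only [one_ne_zero, if_false, Nat.cast_one]
        rw [abs_of_nonneg (by positivity)]
      · intro k hk
        rw [if_neg (by omega)]
        obtain ⟨h1, h2⟩ := hinv k hk
        rw [abs_of_nonneg (by positivity)]
        nlinarith [mul_le_mul_of_nonneg_left h2 (sq_nonneg (1 / ((k : ℝ) - v)))]

lemma sums_half {ι : Type*} [Fintype ι] (L : ℕ) (hL : 64 ≤ L) (y : ι → ℝ)
    (hsep : ∀ i j, i ≠ j → 1 ≤ rho L (y i - y j)) (i : ι) (t : ℝ)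
    (ht : ∀ j, rho L (t - y i) ≤ rho L (t - y j)) :
    (∀ j, j ≠ i → 1 / 2 ≤ rho L (t - y j)) ∧
    ∑ j ∈ univ.erase i, EE L (t - y j) ^ 4 ≤ 37.44 ∧
    ∑ j ∈ univ.erase i, EE L (t - y j) ^ 3 ≤ 23 := by
  have hL0 : 0 < L := by omega
  have htri : ∀ j, rho L (y j - y i) / 2 ≤ rho L (t - y j) := by
    intro j
    have h := rho_add L hL0 (y j - t) (t - y i)
    have h2 := rho_neg L hL0 (t - y j)
    rw [neg_sub] at h2
    rw [h2] at h
    have e : y j - t + (t - y i) = y j - y i := by ring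
    rw [e] at h
    linarith [ht j]
  have hk : ∀ j, j ≠ i → 1 ≤ ⌊rho L (y j - y i)⌋₊ := by
    intro j hj; rw [Nat.one_le_floor_iff]; exact hsep j i hj
  have hfl : ∀ j, (⌊rho L (y j - y i)⌋₊ : ℝ) / 2 ≤ rho L (t - y j) := by
    intro j
    have := Nat.floor_le (a := rho L (y j - y i)) (abs_nonneg _)
    linarith [htri j]
  have hE : ∀ j, j ≠ i → _ := fun j hj => EE_bds L hL (t - y j) (⌊rho L (y j - y i)⌋₊ / 2) (by
    have : (1 : ℝ) ≤ ⌊rho L (y j - y i)⌋₊ := by exact_mod_cast hk j hj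
    linarith) (hfl j)
  have hinv : ∀ k : ℕ, 2 ≤ k → 0 < 1 / ((k : ℝ)) ∧ 1 / ((k : ℝ)) ≤ 1 / 2 := by
    intro k hk
    have : (2 : ℝ) ≤ k := by exact_mod_cast hk
    constructor
    · positivity
    · gcongr
  have he : ∀ k : ℕ, 1 / ((k : ℝ) / 2) = 2 * (1 / (k : ℝ)) := by
    intro k; rw [one_div_div]; ring
  refine ⟨fun j hj => by linarith [htri j, hsep j i hj], ?_, ?_⟩
  · refine (sum_bins L hL0 y hsep i _
      (fun k => (1 / ((k : ℝ) / 2)) ^ 4 + 0.0072 * (1 / ((k : ℝ) / 2)) ^ 2) (16.0288 + 4.0288 / (1.5 - 0)) ?_ ?_ ?_).trans (by norm_num)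
    · intro k; positivity
    · intro j hj
      exact (hE j hj).2.2.1
    · intro K
      apply sum_tail _ 0 _ _ (by norm_num) (by norm_num) (by norm_num)
      · norm_num
      · intro k hk
        rw [he, sub_zero]
        obtain ⟨h1, h2⟩ := hinv k hk
        have : (1 / ((k : ℝ))) ^ 2 ≤ (1 / 2) ^ 2 := by gcongr
        nlinarith [sq_nonneg (1 / ((k : ℝ)))]
  · refine (sum_bins L hL0 y hsep i _
      (fun k => (1 / ((k : ℝ) / 2)) ^ 3 + 0.123 * (1 / ((k : ℝ) / 2)) ^ 2) (8.492 + 4.492 / (1.5 - 0)) ?_ ?_ ?_).trans (by norm_num)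
    · intro k; positivity
    · intro j hj
      exact (hE j hj).2.2.2
    · intro K
      apply sum_tail _ 0 _ _ (by norm_num) (by norm_num) (by norm_num)
      · norm_num
      · intro k hk
        rw [he, sub_zero]
        obtain ⟨h1, h2⟩ := hinv k hk
        nlinarith [mul_le_mul_of_nonneg_left h2 (sq_nonneg (1 / ((k : ℝ))))]

lemma sgE_bound (L : ℕ) (hL : 0 < L) (a b u : ℝ) (hd : dd L u ≠ 0) :
    |a + b * sg L u| * EE L u ^ 4 ≤ |a| * EE L u ^ 4 + |b| * EE L u ^ 3 := by
  have h := sg_EE L hL u hd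
  have hE := EE_nonneg L u
  have h1 : |a + b * sg L u| ≤ |a| + |b| * |sg L u| := by
    rw [← abs_mul]; exact abs_add_le _ _
  calc _ ≤ (|a| + |b| * |sg L u|) * EE L u ^ 4 := by gcongr
    _ = |a| * EE L u ^ 4 + |b| * ((|sg L u| * EE L u) * EE L u ^ 3) := by ring
    _ ≤ |a| * EE L u ^ 4 + |b| * (1 * EE L u ^ 3) := by gcongr
    _ = _ := by ring

lemma G0_bound (L : ℕ) (hL : 0 < L) (a b u : ℝ) (hd : dd L u ≠ 0) :
    |G0 L a b u| ≤ (|a| * EE L u ^ 4 + |b| * EE L u ^ 3) / 97.4 := by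
  unfold G0
  have h := sgE_bound L hL a b u hd
  have h0 := env0 L hL u hd
  rw [abs_mul, abs_of_nonneg (by positivity : 0 ≤ S0 L u ^ 4)]
  calc _ ≤ EE L u ^ 4 / 97.4 * |a + b * sg L u| := by gcongr
    _ = |a + b * sg L u| * EE L u ^ 4 / 97.4 := by ring
    _ ≤ _ := by gcongr

lemma sg1_le (L : ℕ) (u : ℝ) : |sg1 L u| ≤ 1 := abs_cos_le_one _
lemma sg2_le (L : ℕ) (hL : 64 ≤ L) (u : ℝ) : |sg2 L u| ≤ 0.1 := by
  have hL64 : (64 : ℝ) ≤ L := by exact_mod_cast hL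
  unfold sg2
  rw [abs_neg, abs_mul]
  have h := abs_sin_le_one (2 * π * u / L)
  have : |2 * π / (L : ℝ)| ≤ 0.1 := by
    rw [abs_of_nonneg (by positivity), div_le_iff₀ (by linarith)]
    have := pi_lt_d4
    linarith
  calc |2 * π / (L:ℝ)| * |sin (2 * π * u / L)| ≤ 0.1 * 1 := by gcongr
    _ = 0.1 := by norm_num

lemma G1_bound (L : ℕ) (hL : 0 < L) (a b u e : ℝ) (hd : dd L u ≠ 0) (he : EE L u ≤ e) :
    |G1 L a b u| ≤ (4.09 + 4 * e) / 97.4 * (|a| * EE L u ^ 4 + |b| * EE L u ^ 3)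
      + |b| * EE L u ^ 4 / 97.4 := by
  unfold G1
  have h := sgE_bound L hL a b u hd
  have h0 := env0 L hL u hd
  have h1 := env1 L hL u hd
  have hE := EE_nonneg L u
  have hs := sg1_le L u
  refine (abs_add_le _ _).trans ?_
  gcongr
  · rw [abs_mul]
    calc _ ≤ EE L u ^ 4 * (4.09 + 4 * e) / 97.4 * |a + b * sg L u| := by
          gcongr; refine h1.trans ?_; gcongr
      _ = (4.09 + 4 * e) / 97.4 * (|a + b * sg L u| * EE L u ^ 4) := by ring
      _ ≤ _ := by
        have : 0 ≤ e := hE.trans he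
        gcongr
  · rw [abs_mul, abs_of_nonneg (by positivity : 0 ≤ S0 L u ^ 4), abs_mul]
    calc _ ≤ EE L u ^ 4 / 97.4 * (|b| * 1) := by gcongr
      _ = _ := by ring

lemma G2_bound (L : ℕ) (hL : 64 ≤ L) (a b u e : ℝ) (hd : dd L u ≠ 0) (he : EE L u ≤ e) :
    |G2 L a b u| ≤ (39.5 + 32.7 * e + 20 * e ^ 2) / 97.4 * (|a| * EE L u ^ 4 + |b| * EE L u ^ 3)
      + (8.28 + 8 * e) / 97.4 * (|b| * EE L u ^ 4) := by
  have hL0 : 0 < L := by omega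
  unfold G2
  have h := sgE_bound L hL0 a b u hd
  have h0 := env0 L hL0 u hd
  have h1 := env1 L hL0 u hd
  have h2 := env2 L hL u hd
  have hE := EE_nonneg L u
  have hs := sg1_le L u
  have hs2 := sg2_le L hL u
  have he0 : 0 ≤ e := hE.trans he
  have t1 : |J2 L u * (a + b * sg L u)| ≤ (39.5 + 32.7 * e + 20 * e ^ 2) / 97.4 * (|a| * EE L u ^ 4 + |b| * EE L u ^ 3) := by
    rw [abs_mul]
    calc _ ≤ EE L u ^ 4 * (39.5 + 32.7 * e + 20 * e ^ 2) / 97.4 * |a + b * sg L u| := by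
          gcongr; refine h2.trans ?_; gcongr
      _ = (39.5 + 32.7 * e + 20 * e ^ 2) / 97.4 * (|a + b * sg L u| * EE L u ^ 4) := by ring
      _ ≤ _ := by gcongr
  have t2 : |2 * J1 L u * (b * sg1 L u)| ≤ 2 * (EE L u ^ 4 * (4.09 + 4 * e) / 97.4) * (|b| * 1) := by
    rw [abs_mul, abs_mul, abs_mul, abs_two]
    gcongr
    refine h1.trans ?_; gcongr
  have t3 : |S0 L u ^ 4 * (b * sg2 L u)| ≤ EE L u ^ 4 / 97.4 * (|b| * 0.1) := by
    rw [abs_mul, abs_of_nonneg (by positivity : 0 ≤ S0 L u ^ 4), abs_mul]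
    gcongr
  have := abs_add_three (J2 L u * (a + b * sg L u)) (2 * J1 L u * (b * sg1 L u)) (S0 L u ^ 4 * (b * sg2 L u))
  refine this.trans ((add_le_add (add_le_add t1 t2) t3).trans (le_of_eq ?_))
  ring

end SD

namespace SD
open Real

lemma taylor_pos (R R1 R2 : ℝ → ℝ) (B c : ℝ) (h0 : ∀ x, HasDerivAt R (R1 x) x)
    (h1 : ∀ x, HasDerivAt R1 (R2 x) x) (hB : ∀ x, |x| ≤ c → |R2 x| ≤ B) (x : ℝ) (hx0 : 0 ≤ x)
    (hx : x ≤ c) : |R x - R 0 - R1 0 * x| ≤ B * x ^ 2 / 2 := by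
  have s1 : ∀ x ∈ Set.Icc 0 c, ‖R1 x - R1 0‖ ≤ B * x := by
    intro x hx
    refine image_norm_le_of_norm_deriv_right_le_deriv_boundary (f := fun x => R1 x - R1 0)
      (f' := R2) (B := fun x => B * x) (B' := fun _ => B) (a := 0) (b := c) ?_ ?_ ?_ ?_ ?_ hx
    · exact fun x _ => ((h1 x).sub_const _).continuousAt.continuousWithinAt
    · exact fun x _ => ((h1 x).sub_const _).hasDerivWithinAt
    · simp
    · intro x; simpa using (hasDerivAt_id x).const_mul B
    · intro x hx
      exact hB x (by rw [abs_of_nonneg hx.1]; exact hx.2.le)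
  have hd : ∀ x, HasDerivAt (fun x => R x - R 0 - R1 0 * x) (R1 x - R1 0) x := by
    intro x
    have := ((h0 x).sub_const (R 0)).sub ((hasDerivAt_id x).const_mul (R1 0))
    exact this.congr_deriv (by simp)
  refine image_norm_le_of_norm_deriv_right_le_deriv_boundary (f := fun x => R x - R 0 - R1 0 * x)
      (f' := fun x => R1 x - R1 0) (B := fun x => B * x ^ 2 / 2) (B' := fun x => B * x)
      (a := 0) (b := c) ?_ ?_ ?_ ?_ ?_ ⟨hx0, hx⟩
  · exact fun x _ => (hd x).continuousAt.continuousWithinAt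
  · exact fun x _ => (hd x).hasDerivWithinAt
  · simp
  · intro x
    exact ((((hasDerivAt_id x).pow 2).const_mul B).div_const 2).congr_deriv (by simp; ring)
  · intro x hx
    exact s1 x ⟨hx.1, hx.2.le⟩

lemma taylor2 (R R1 R2 : ℝ → ℝ) (B c : ℝ) (h0 : ∀ x, HasDerivAt R (R1 x) x)
    (h1 : ∀ x, HasDerivAt R1 (R2 x) x) (hB : ∀ x, |x| ≤ c → |R2 x| ≤ B) (x : ℝ)
    (hx : |x| ≤ c) : |R x - R 0 - R1 0 * x| ≤ B * x ^ 2 / 2 := by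
  rcases le_total 0 x with h | h
  · exact taylor_pos R R1 R2 B c h0 h1 hB x h (by rwa [abs_of_nonneg h] at hx)
  · have n0 : ∀ x, HasDerivAt (fun x => R (-x)) (-R1 (-x)) x := by
      intro x
      exact (HasDerivAt.comp x (h0 (-x)) (hasDerivAt_neg x)).congr_deriv (by ring)
    have n1 : ∀ x, HasDerivAt (fun x => -R1 (-x)) (R2 (-x)) x := by
      intro x
      exact (HasDerivAt.comp x (h1 (-x)) (hasDerivAt_neg x)).neg.congr_deriv (by ring)
    have := taylor_pos (fun x => R (-x)) (fun x => -R1 (-x)) (fun x => R2 (-x)) B c n0 n1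
      (fun x hx => hB (-x) (by rwa [abs_neg])) (-x) (by linarith) (by rwa [abs_of_nonpos h] at hx)
    simpa using this

section sums
variable {ι : Type*}

lemma sum_bd (A : Finset ι) (F p q a b : ι → ℝ) (α β q4 q3 c1 c2 : ℝ) (hα : 0 ≤ α) (hβ : 0 ≤ β)
    (hc1 : 0 ≤ c1) (hc2 : 0 ≤ c2) (hp : ∀ j, 0 ≤ p j) (hq : ∀ j, 0 ≤ q j)
    (ha : ∀ j, |a j| ≤ α) (hb : ∀ j, |b j| ≤ β)
    (hF : ∀ j ∈ A, |F j| ≤ c1 * (|a j| * p j + |b j| * q j) + c2 * (|b j| * p j))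
    (h4 : ∑ j ∈ A, p j ≤ q4) (h3 : ∑ j ∈ A, q j ≤ q3) :
    |∑ j ∈ A, F j| ≤ c1 * (α * q4 + β * q3) + c2 * (β * q4) := by
  calc |∑ j ∈ A, F j| ≤ ∑ j ∈ A, |F j| := abs_sum_le_sum_abs _ _
    _ ≤ ∑ j ∈ A, (c1 * (α * p j + β * q j) + c2 * (β * p j)) := by
      apply sum_le_sum
      intro j hj
      refine (hF j hj).trans ?_
      have := hp j; have := hq j; have := ha j; have := hb j
      gcongr
    _ = c1 * (α * ∑ j ∈ A, p j + β * ∑ j ∈ A, q j) + c2 * (β * ∑ j ∈ A, p j) := by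
      rw [sum_add_distrib, ← mul_sum, ← mul_sum, sum_add_distrib, ← mul_sum, ← mul_sum, ← mul_sum]
    _ ≤ _ := by gcongr

variable (L : ℕ) (A : Finset ι) (a b u : ι → ℝ) (α β q4 q3 : ℝ)

lemma G0_sum (hL : 0 < L) (hα : 0 ≤ α) (hβ : 0 ≤ β) (ha : ∀ j, |a j| ≤ α) (hb : ∀ j, |b j| ≤ β)
    (hd : ∀ j ∈ A, dd L (u j) ≠ 0)
    (h4 : ∑ j ∈ A, EE L (u j) ^ 4 ≤ q4) (h3 : ∑ j ∈ A, EE L (u j) ^ 3 ≤ q3) :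
    |∑ j ∈ A, G0 L (a j) (b j) (u j)| ≤ (α * q4 + β * q3) / 97.4 := by
  have := sum_bd A (fun j => G0 L (a j) (b j) (u j)) (fun j => EE L (u j) ^ 4)
    (fun j => EE L (u j) ^ 3) a b α β q4 q3 (1 / 97.4) 0 hα hβ (by norm_num) le_rfl
    (fun j => by have := EE_nonneg L (u j); positivity)
    (fun j => by have := EE_nonneg L (u j); positivity) ha hb
    (fun j hj => (G0_bound L hL (a j) (b j) (u j) (hd j hj)).trans (le_of_eq (by ring))) h4 h3
  exact this.trans (le_of_eq (by ring))

lemma G1_sum (e : ℝ) (he0 : 0 ≤ e) (hL : 0 < L) (hα : 0 ≤ α) (hβ : 0 ≤ β) (ha : ∀ j, |a j| ≤ α) (hb : ∀ j, |b j| ≤ β)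
    (hd : ∀ j ∈ A, dd L (u j) ≠ 0) (he : ∀ j ∈ A, EE L (u j) ≤ e)
    (h4 : ∑ j ∈ A, EE L (u j) ^ 4 ≤ q4) (h3 : ∑ j ∈ A, EE L (u j) ^ 3 ≤ q3) :
    |∑ j ∈ A, G1 L (a j) (b j) (u j)| ≤
      (4.09 + 4 * e) / 97.4 * (α * q4 + β * q3) + 1 / 97.4 * (β * q4) := by
  exact sum_bd A (fun j => G1 L (a j) (b j) (u j)) (fun j => EE L (u j) ^ 4)
    (fun j => EE L (u j) ^ 3) a b α β q4 q3 ((4.09 + 4 * e) / 97.4) (1 / 97.4) hα hβ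
    (by positivity) (by positivity)
    (fun j => by have := EE_nonneg L (u j); positivity)
    (fun j => by have := EE_nonneg L (u j); positivity) ha hb
    (fun j hj => (G1_bound L hL (a j) (b j) (u j) e (hd j hj) (he j hj)).trans (le_of_eq (by ring))) h4 h3

lemma G2_sum (e : ℝ) (he0 : 0 ≤ e) (hL : 64 ≤ L) (hα : 0 ≤ α) (hβ : 0 ≤ β) (ha : ∀ j, |a j| ≤ α) (hb : ∀ j, |b j| ≤ β)
    (hd : ∀ j ∈ A, dd L (u j) ≠ 0) (he : ∀ j ∈ A, EE L (u j) ≤ e)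
    (h4 : ∑ j ∈ A, EE L (u j) ^ 4 ≤ q4) (h3 : ∑ j ∈ A, EE L (u j) ^ 3 ≤ q3) :
    |∑ j ∈ A, G2 L (a j) (b j) (u j)| ≤
      (39.5 + 32.7 * e + 20 * e ^ 2) / 97.4 * (α * q4 + β * q3) + (8.28 + 8 * e) / 97.4 * (β * q4) := by
  exact sum_bd A (fun j => G2 L (a j) (b j) (u j)) (fun j => EE L (u j) ^ 4)
    (fun j => EE L (u j) ^ 3) a b α β q4 q3 _ _ hα hβ
    (by positivity) (by positivity)
    (fun j => by have := EE_nonneg L (u j); positivity)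
    (fun j => by have := EE_nonneg L (u j); positivity) ha hb
    (fun j hj => (G2_bound L hL (a j) (b j) (u j) e (hd j hj) (he j hj))) h4 h3
end sums

lemma S0_zero (L : ℕ) (hL : 0 < L) : S0 L 0 = 1 := by
  have : (L : ℝ) ≠ 0 := by positivity
  unfold S0; simp; field_simp
lemma S1_zero (L : ℕ) : S1 L 0 = 0 := by unfold S1; simp
lemma G0_zero (L : ℕ) (hL : 0 < L) (a b : ℝ) : G0 L a b 0 = a := by
  unfold G0 sg; rw [S0_zero L hL]; simp
lemma G1_zero (L : ℕ) (hL : 0 < L) (a b : ℝ) : G1 L a b 0 = b := by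
  unfold G1 J1 sg1; rw [S0_zero L hL, S1_zero]; simp

lemma rho_zero (L : ℕ) (hL : 0 < L) : rho L 0 = 0 := by unfold rho; simp

section cert
variable {ι : Type*} [Fintype ι] (L : ℕ) (y : ι → ℝ)

lemma apriori (hL : 64 ≤ L) (hsep : ∀ i j, i ≠ j → 1 ≤ rho L (y i - y j)) (a b : ι → ℝ) (m : ℝ)
    (h0 : ∀ i, |∑ j, G0 L (a j) (b j) (y i - y j)| ≤ m)
    (h1 : ∀ i, ∑ j, G1 L (a j) (b j) (y i - y j) = 0) :
    ∀ i, |a i| ≤ 1.0341 * m ∧ |b i| ≤ 0.2853 * m := by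
  have hL0 : 0 < L := by omega
  intro i0
  haveI : Nonempty ι := ⟨i0⟩
  obtain ⟨ia, ha⟩ := Finite.exists_max (fun i => |a i|)
  obtain ⟨ib, hb⟩ := Finite.exists_max (fun i => |b i|)
  have key : ∀ i, |a i| ≤ m + (|a ia| * 2.3574 + |b ib| * 3.0767) / 97.4 ∧
      |b i| ≤ (4.09 + 4 * 1.022) / 97.4 * (|a ia| * 2.3574 + |b ib| * 3.0767) + 1 / 97.4 * (|b ib| * 2.3574) := by
    intro i
    obtain ⟨hr, h4, h3⟩ := sums_v L hL y hsep i (y i) 0 le_rfl (by norm_num) (by rw [sub_self, rho_zero L hL0])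
    have q4 : 2 * Q4 0 ≤ 2.3574 := by unfold Q4; norm_num
    have q3 : 2 * Q3 0 ≤ 3.0767 := by unfold Q3; norm_num
    have hE : ∀ j ∈ univ.erase i, dd L (y i - y j) ≠ 0 ∧ EE L (y i - y j) ≤ 1.022 := by
      intro j hj
      have := EE_bds L hL (y i - y j) 1 one_pos (by have := hr j (mem_erase.mp hj).1; linarith)
      exact ⟨this.1, this.2.1.trans (by norm_num)⟩
    have g0 := G0_sum L (univ.erase i) a b (fun j => y i - y j) (|a ia|) (|b ib|) 2.3574 3.0767 hL0
      (abs_nonneg _) (abs_nonneg _) ha hb (fun j hj => (hE j hj).1) (h4.trans q4) (h3.trans q3)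
    have g1 := G1_sum L (univ.erase i) a b (fun j => y i - y j) (|a ia|) (|b ib|) 2.3574 3.0767 1.022
      (by norm_num) hL0
      (abs_nonneg _) (abs_nonneg _) ha hb (fun j hj => (hE j hj).1) (fun j hj => (hE j hj).2) (h4.trans q4) (h3.trans q3)
    have e0 := add_sum_erase univ (fun j => G0 L (a j) (b j) (y i - y j)) (mem_univ i)
    have e1 := add_sum_erase univ (fun j => G1 L (a j) (b j) (y i - y j)) (mem_univ i)
    simp only [sub_self, G0_zero L hL0, G1_zero L hL0] at e0 e1
    have h1i := h1 i
    have h0i := h0 i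
    constructor
    · have : a i = ∑ j, G0 L (a j) (b j) (y i - y j) - ∑ j ∈ univ.erase i, G0 L (a j) (b j) (y i - y j) := by
        rw [← e0]; ring
      rw [this]
      exact (abs_sub _ _).trans (add_le_add h0i g0)
    · have : b i = - ∑ j ∈ univ.erase i, G1 L (a j) (b j) (y i - y j) := by
        rw [h1i] at e1; linarith
      rw [this, abs_neg]
      exact g1
  have k1 := (key ia).1
  have k2 := (key ib).2
  have n1 := ha i0
  have n2 := hb i0
  have p1 := abs_nonneg (a ia)
  have p2 := abs_nonneg (b ib)
  norm_num at k1 k2 n1 n2 ⊢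
  constructor <;> linarith

lemma exists_coeff (hL : 64 ≤ L) (hsep : ∀ i j, i ≠ j → 1 ≤ rho L (y i - y j)) (s : ι → ℝ) :
    ∃ a b : ι → ℝ, (∀ i, ∑ j, G0 L (a j) (b j) (y i - y j) = s i) ∧
      (∀ i, ∑ j, G1 L (a j) (b j) (y i - y j) = 0) := by
  let T : ((ι → ℝ) × (ι → ℝ)) →ₗ[ℝ] ((ι → ℝ) × (ι → ℝ)) :=
    { toFun := fun p => (fun i => ∑ j, G0 L (p.1 j) (p.2 j) (y i - y j),
        fun i => ∑ j, G1 L (p.1 j) (p.2 j) (y i - y j))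
      map_add' := by
        intro p q
        ext i
        · simp only [Prod.fst_add, Prod.snd_add, Pi.add_apply, ← sum_add_distrib]
          refine sum_congr rfl fun j _ => ?_
          unfold G0; ring
        · simp only [Prod.fst_add, Prod.snd_add, Pi.add_apply, ← sum_add_distrib]
          refine sum_congr rfl fun j _ => ?_
          unfold G1; ring
      map_smul' := by
        intro c p
        ext i
        · simp only [Prod.smul_fst, Prod.smul_snd, Pi.smul_apply, smul_eq_mul, RingHom.id_apply, mul_sum]
          refine sum_congr rfl fun j _ => ?_
          unfold G0; ring
        · simp only [Prod.smul_fst, Prod.smul_snd, Pi.smul_apply, smul_eq_mul, RingHom.id_apply, mul_sum]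
          refine sum_congr rfl fun j _ => ?_
          unfold G1; ring }
  have hinj : Function.Injective T := by
    rw [← LinearMap.ker_eq_bot, LinearMap.ker_eq_bot']
    intro p hp
    have hp1 : ∀ i, ∑ j, G0 L (p.1 j) (p.2 j) (y i - y j) = 0 := fun i => congrFun (congrArg Prod.fst hp) i
    have hp2 : ∀ i, ∑ j, G1 L (p.1 j) (p.2 j) (y i - y j) = 0 := fun i => congrFun (congrArg Prod.snd hp) i
    have := apriori L y hL hsep p.1 p.2 0 (fun i => by rw [hp1 i, abs_zero]) hp2
    ext i
    · have h := (this i).1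
      rw [mul_zero] at h
      exact abs_nonpos_iff.mp h
    · have h := (this i).2
      rw [mul_zero] at h
      exact abs_nonpos_iff.mp h
  obtain ⟨p, hp⟩ := (LinearMap.injective_iff_surjective.mp hinj) (s, 0)
  exact ⟨p.1, p.2, fun i => congrFun (congrArg Prod.fst hp) i, fun i => congrFun (congrArg Prod.snd hp) i⟩
end cert

end SD

namespace SD
open Real

lemma S0_sq_per (L : ℕ) (hL : 0 < L) (u : ℝ) (z : ℤ) : S0 L (u + z * L) ^ 4 = S0 L u ^ 4 := by
  have hL' : (L : ℝ) ≠ 0 := by positivity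
  have key : S0 L (u + z * L) = (-1 : ℝ) ^ (z * (1 - (L : ℤ))) * S0 L u := by
    unfold S0
    rw [mul_left_comm]
    congr 1
    rw [mul_sum]
    apply sum_congr rfl
    intro j _
    have : om L j * (u + z * L) = om L j * u + ((z * j : ℤ) : ℝ) * (2 * π) + ((z * (1 - (L : ℤ)) : ℤ) : ℝ) * π := by
      unfold om; push_cast; field_simp; ring
    rw [this, cos_add_int_mul_pi, cos_add_int_mul_two_pi]
  rw [key, mul_pow]
  rcases Int.even_or_odd (z * (1 - (L : ℤ))) with h | h <;> rw [h.neg_one_zpow] <;> norm_num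

lemma G0_per (L : ℕ) (hL : 0 < L) (a b u : ℝ) (z : ℤ) : G0 L a b (u + z * L) = G0 L a b u := by
  have hL' : (L : ℝ) ≠ 0 := by positivity
  unfold G0 sg
  rw [S0_sq_per L hL]
  have : 2 * π * (u + z * L) / L = 2 * π * u / L + z * (2 * π) := by field_simp
  rw [this, sin_add_int_mul_two_pi]

lemma sin_cube (x : ℝ) : |sin x - x| ≤ |x| ^ 3 / 6 := by
  wlog h : 0 ≤ x generalizing x
  · have := this (-x) (by linarith)
    rw [abs_neg, sin_neg, ← abs_neg] at this
    convert this using 2; ring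
  rw [abs_of_nonneg h, abs_le]
  have := sin_ge_sub_cube h
  have := sin_le h
  constructor
  · linarith
  · have : 0 ≤ x ^ 3 / 6 := by positivity
    linarith

lemma sg_near (L : ℕ) (hL : 64 ≤ L) (u : ℝ) : |sg L u - u| ≤ 0.01 * |u| ^ 3 := by
  have hL' : (64 : ℝ) ≤ L := by exact_mod_cast hL
  have hL0 : (0 : ℝ) < L := by linarith
  have hp := pi_pos
  have h := sin_cube (2 * π * u / L)
  have e : sg L u - u = L / (2 * π) * (sin (2 * π * u / L) - 2 * π * u / L) := by
    unfold sg; field_simp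
  rw [e, abs_mul, abs_of_pos (by positivity : 0 < (L : ℝ) / (2 * π))]
  calc _ ≤ (L : ℝ) / (2 * π) * (|2 * π * u / L| ^ 3 / 6) := by gcongr
    _ = (2 * π / L) ^ 2 / 6 * |u| ^ 3 := by
      rw [abs_div, abs_mul, abs_of_pos (by positivity : 0 < 2 * π), abs_of_pos hL0]
      field_simp
    _ ≤ _ := by
      gcongr
      have : 2 * π / L ≤ 0.1 := by
        rw [div_le_iff₀ hL0]; have := pi_lt_d4; linarith
      have h2 : (2 * π / L) ^ 2 ≤ 0.1 ^ 2 := by gcongr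
      norm_num at h2 ⊢; linarith

section cert
variable {ι : Type*} [Fintype ι] (L : ℕ) (y : ι → ℝ)

lemma near_num (s a b J σ τ T : ℝ) (S : ℝ) (hJ : J = S ^ 4) (hτ : |τ| ≤ 0.2)
    (hs : |s| = 1) (has : |a - s| ≤ 0.0341) (hb : |b| ≤ 0.2853)
    (hS1 : 1 - 1.645 * τ ^ 2 ≤ S) (hS2 : S ≤ 1 - 1.6445 * τ ^ 2 + 0.812 * τ ^ 4)
    (hσ : |σ - τ| ≤ 0.01 * |τ| ^ 3) (hT : |T| ≤ 8.56 * τ ^ 2 / 2) :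
    |J * (a + b * σ) + (s - a - b * τ + T)| ≤ 1 - 0.9 * τ ^ 2 := by
  have hv := abs_nonneg τ
  have hv2 : τ ^ 2 = |τ| ^ 2 := (sq_abs τ).symm
  have hv4 : τ ^ 4 = |τ| ^ 4 := by rw [← abs_pow]; exact (abs_of_nonneg (by positivity)).symm
  rw [hv2] at hS1 hS2 hT ⊢
  rw [hv4] at hS2
  have hvv : |τ| ^ 2 ≤ 0.04 := by nlinarith
  have hv3 : |τ| ^ 3 ≤ 0.2 * |τ| ^ 2 := by nlinarith [sq_nonneg |τ|]
  have hS2' : S ≤ 1 - 1.612 * |τ| ^ 2 := by nlinarith [sq_nonneg |τ|]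
  have hS3 : 0.9342 ≤ S := by linarith
  have hv22 := sq_nonneg |τ|
  have hS4 : S ≤ 1 := by linarith
  have hJ1 : J ≤ 1 - 5.83 * |τ| ^ 2 := by
    have e : 1 - J = (1 - S) * (1 + S + S ^ 2 + S ^ 3) := by rw [hJ]; ring
    have h2 : (0.9342 : ℝ) ^ 2 ≤ S ^ 2 := by gcongr
    have h3 : (0.9342 : ℝ) ^ 3 ≤ S ^ 3 := by gcongr
    have h4 : 3.62 ≤ 1 + S + S ^ 2 + S ^ 3 := by norm_num at h2 h3 ⊢; linarith
    have h5 : 1.612 * |τ| ^ 2 * 3.62 ≤ (1 - S) * (1 + S + S ^ 2 + S ^ 3) := by gcongr; linarith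
    rw [← e] at h5
    linarith
  have hJ2 : 1 - 6.58 * |τ| ^ 2 ≤ J := by
    have e : 1 - J = (1 - S) * (1 + S + S ^ 2 + S ^ 3) := by rw [hJ]; ring
    have h2 : S ^ 2 ≤ 1 := by nlinarith
    have h3 : S ^ 3 ≤ 1 := by nlinarith
    have h4 : 1 + S + S ^ 2 + S ^ 3 ≤ 4 := by linarith
    have h5 : (1 - S) * (1 + S + S ^ 2 + S ^ 3) ≤ (1.645 * |τ| ^ 2) * 4 := by
      gcongr
      linarith
    rw [← e] at h5
    linarith
  have hJ0 : 0 ≤ J := by rw [hJ]; positivity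
  have hJ3 : J ≤ 1 := by linarith
  have hst : |σ * J - τ| ≤ 1.318 * |τ| ^ 2 := by
    have e : σ * J - τ = (σ - τ) * J - τ * (1 - J) := by ring
    rw [e]
    refine (abs_sub _ _).trans ?_
    rw [abs_mul, abs_mul, abs_of_nonneg hJ0, abs_of_nonneg (by linarith : 0 ≤ 1 - J)]
    have h1 : |σ - τ| * J ≤ 0.01 * |τ| ^ 3 * 1 := by gcongr
    have h2 : |τ| * (1 - J) ≤ |τ| * (6.58 * |τ| ^ 2) := by gcongr; linarith
    have h3 : |τ| * (6.58 * |τ| ^ 2) = 6.58 * |τ| ^ 3 := by ring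
    linarith
  have hbst : |b * (σ * J - τ)| ≤ 0.377 * |τ| ^ 2 := by
    rw [abs_mul]
    calc _ ≤ 0.2853 * (1.318 * |τ| ^ 2) := by gcongr
      _ ≤ _ := by linarith
  have e : J * (a + b * σ) + (s - a - b * τ + T) = s - a * (1 - J) + b * (σ * J - τ) + T := by ring
  rw [e]
  rw [abs_le] at hbst hT has
  rcases (abs_eq (by norm_num)).mp hs with rfl | rfl
  · have a1 : 0.9659 * (5.83 * |τ| ^ 2) ≤ a * (1 - J) := by gcongr <;> linarith
    have a2 : a * (1 - J) ≤ 1.0341 * (6.58 * |τ| ^ 2) := by gcongr <;> linarith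
    rw [abs_le]; constructor <;> linarith
  · have a1 : 0.9659 * (5.83 * |τ| ^ 2) ≤ (-a) * (1 - J) := by gcongr <;> linarith
    have a2 : (-a) * (1 - J) ≤ 1.0341 * (6.58 * |τ| ^ 2) := by gcongr <;> linarith
    rw [abs_le]; constructor <;> linarith

variable (a b s : ι → ℝ)

lemma near (hL : 64 ≤ L) (hsep : ∀ i j, i ≠ j → 1 ≤ rho L (y i - y j)) (hs : ∀ i, |s i| = 1)
    (h0 : ∀ i, ∑ j, G0 L (a j) (b j) (y i - y j) = s i)
    (h1 : ∀ i, ∑ j, G1 L (a j) (b j) (y i - y j) = 0) (i : ι) (τ : ℝ) (hτ : |τ| ≤ 0.2) :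
    |∑ j, G0 L (a j) (b j) (y i + τ - y j)| ≤ 1 - 0.9 * τ ^ 2 := by
  have hL0 : 0 < L := by omega
  have hap := apriori L y hL hsep a b 1 (fun i => by rw [h0 i, hs i]) h1
  have ha : ∀ i, |a i| ≤ 1.0341 := fun i => by have := (hap i).1; rwa [mul_one] at this
  have hb : ∀ i, |b i| ≤ 0.2853 := fun i => by have := (hap i).2; rwa [mul_one] at this
  have e0 := add_sum_erase univ (fun j => G0 L (a j) (b j) (y i - y j)) (mem_univ i)
  have e1 := add_sum_erase univ (fun j => G1 L (a j) (b j) (y i - y j)) (mem_univ i)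
  have eτ := add_sum_erase univ (fun j => G0 L (a j) (b j) (y i + τ - y j)) (mem_univ i)
  simp only [sub_self, G0_zero L hL0, G1_zero L hL0, h0, h1] at e0 e1
  -- a close to s
  have has : |a i - s i| ≤ 0.0341 := by
    obtain ⟨hr, h4, h3⟩ := sums_v L hL y hsep i (y i) 0 le_rfl (by norm_num) (by rw [sub_self, rho_zero L hL0])
    have q4 : 2 * Q4 0 ≤ 2.3574 := by unfold Q4; norm_num
    have q3 : 2 * Q3 0 ≤ 3.0767 := by unfold Q3; norm_num
    have hE : ∀ j ∈ univ.erase i, dd L (y i - y j) ≠ 0 := by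
      intro j hj
      exact (EE_bds L hL (y i - y j) 1 one_pos (by have := hr j (mem_erase.mp hj).1; linarith)).1
    have g0 := G0_sum L (univ.erase i) a b (fun j => y i - y j) 1.0341 0.2853 2.3574 3.0767 hL0
      (by norm_num) (by norm_num) ha hb hE (h4.trans q4) (h3.trans q3)
    have : a i - s i = - ∑ j ∈ univ.erase i, G0 L (a j) (b j) (y i - y j) := by rw [← e0]; ring
    rw [this, abs_neg]
    exact g0.trans (by norm_num)
  have q4 : 2 * Q4 0.2 ≤ 5.3914 := by unfold Q4; norm_num
  have q3 : 2 * Q3 0.2 ≤ 5.3347 := by unfold Q3; norm_num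
  have hT := taylor2 (fun x => ∑ j ∈ univ.erase i, G0 L (a j) (b j) (y i + x - y j))
    (fun x => ∑ j ∈ univ.erase i, G1 L (a j) (b j) (y i + x - y j))
    (fun x => ∑ j ∈ univ.erase i, G2 L (a j) (b j) (y i + x - y j)) 8.56 0.2 (by
      intro x
      apply HasDerivAt.fun_sum
      intro j _
      have h := (hasDerivAt_G0 L hL0 (a j) (b j) (y i + x - y j)).comp x
        (((hasDerivAt_id x).const_add (y i)).sub_const (y j))
      exact h.congr_deriv (by ring)) (by
      intro x
      apply HasDerivAt.fun_sum
      intro j _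
      have h := (hasDerivAt_G1 L hL0 (a j) (b j) (y i + x - y j)).comp x
        (((hasDerivAt_id x).const_add (y i)).sub_const (y j))
      exact h.congr_deriv (by ring)) (by
      intro x hx
      obtain ⟨hr, h4, h3⟩ := sums_v L hL y hsep i (y i + x) 0.2 (by norm_num) (by norm_num) (by
        refine le_trans ?_ hx
        have := rho_le L hL0 x 0
        simpa using this)
      have hE : ∀ j ∈ univ.erase i, dd L (y i + x - y j) ≠ 0 ∧ EE L (y i + x - y j) ≤ 1.272 := by
        intro j hj
        have := EE_bds L hL (y i + x - y j) 0.8 (by norm_num) (by have := hr j (mem_erase.mp hj).1; linarith)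
        exact ⟨this.1, this.2.1.trans (by norm_num)⟩
      have g2 := G2_sum L (univ.erase i) a b (fun j => y i + x - y j) 1.0341 0.2853 5.3914 5.3347 1.272
        (by norm_num) hL (by norm_num) (by norm_num) ha hb (fun j hj => (hE j hj).1)
        (fun j hj => (hE j hj).2) (h4.trans q4) (h3.trans q3)
      exact g2.trans (by norm_num)) τ hτ
  simp only [add_zero] at hT
  have r1 : ∑ j ∈ univ.erase i, G1 L (a j) (b j) (y i - y j) = - b i := by linarith
  have r0 : ∑ j ∈ univ.erase i, G0 L (a j) (b j) (y i - y j) = s i - a i := by linarith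
  rw [r1, r0] at hT
  have key := near_num (s i) (a i) (b i) (S0 L τ ^ 4) (sg L τ) τ _ (S0 L τ) rfl hτ (hs i) has (hb i)
    (S0_lower L hL0 τ) (S0_upper L hL τ (by linarith)) (sg_near L hL τ) hT
  rw [← eτ]
  refine le_trans (le_of_eq ?_) key
  congr 1
  simp only [add_sub_cancel_left]
  unfold G0
  ring

/-- bound with other terms for v-zones -/
lemma mid (hL : 64 ≤ L) (hsep : ∀ i j, i ≠ j → 1 ≤ rho L (y i - y j))
    (ha : ∀ i, |a i| ≤ 1.0341) (hb : ∀ i, |b i| ≤ 0.2853) (i : ι) (τ v c q4 q3 : ℝ)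
    (hv0 : 0 ≤ v) (hv : v ≤ 1 / 2)
    (hτ : |τ| ≤ v) (hq4 : 2 * Q4 v ≤ q4) (hq3 : 2 * Q3 v ≤ q3) (hc0 : 0 ≤ c) (hc : |S0 L τ| ≤ c)
    (hnum : c ^ 4 * (1.0341 + 0.2853 * (v + 0.01 * v ^ 3)) + (1.0341 * q4 + 0.2853 * q3) / 97.4 ≤ 0.995) :
    |∑ j, G0 L (a j) (b j) (y i + τ - y j)| ≤ 0.995 := by
  have hL0 : 0 < L := by omega
  have eτ := add_sum_erase univ (fun j => G0 L (a j) (b j) (y i + τ - y j)) (mem_univ i)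
  obtain ⟨hr, h4, h3⟩ := sums_v L hL y hsep i (y i + τ) v hv0 hv (by
        refine le_trans ?_ hτ
        have := rho_le L hL0 τ 0
        simpa using this)
  have hE : ∀ j ∈ univ.erase i, dd L (y i + τ - y j) ≠ 0 := by
    intro j hj
    exact (EE_bds L hL (y i + τ - y j) (1 - v) (by linarith) (hr j (mem_erase.mp hj).1)).1
  have g0 := G0_sum L (univ.erase i) a b (fun j => y i + τ - y j) 1.0341 0.2853 q4 q3 hL0
      (by norm_num) (by norm_num) ha hb hE (h4.trans hq4) (h3.trans hq3)
  rw [← eτ]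
  refine (abs_add_le _ _).trans (le_trans (add_le_add ?_ g0) hnum)
  simp only [add_sub_cancel_left]
  unfold G0
  rw [abs_mul, abs_pow]
  have hs : |sg L τ| ≤ v + 0.01 * v ^ 3 := by
    have h := sg_near L hL τ
    have h2 : |sg L τ| ≤ |sg L τ - τ| + |τ| := by
      have := abs_add_le (sg L τ - τ) τ
      simpa using this
    have h3 : 0.01 * |τ| ^ 3 ≤ 0.01 * v ^ 3 := by gcongr
    linarith
  gcongr
  refine (abs_add_le _ _).trans (add_le_add (ha i) ?_)
  rw [abs_mul]
  have := hb i
  gcongr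

lemma far (hL : 64 ≤ L) (hsep : ∀ i j, i ≠ j → 1 ≤ rho L (y i - y j))
    (ha : ∀ i, |a i| ≤ 1.0341) (hb : ∀ i, |b i| ≤ 0.2853) (i : ι) (t : ℝ)
    (ht : ∀ j, rho L (t - y i) ≤ rho L (t - y j)) (h : 0.4 ≤ rho L (t - y i)) :
    |∑ j, G0 L (a j) (b j) (t - y j)| ≤ 0.995 := by
  have hL0 : 0 < L := by omega
  have eτ := add_sum_erase univ (fun j => G0 L (a j) (b j) (t - y j)) (mem_univ i)
  obtain ⟨hr, h4, h3⟩ := sums_half L hL y hsep i t ht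
  have hE : ∀ j ∈ univ.erase i, dd L (t - y j) ≠ 0 := by
    intro j hj
    exact (EE_bds L hL (t - y j) (1 / 2) (by norm_num) (hr j (mem_erase.mp hj).1)).1
  have g0 := G0_sum L (univ.erase i) a b (fun j => t - y j) 1.0341 0.2853 _ _ hL0
      (by norm_num) (by norm_num) ha hb hE h4 h3
  obtain ⟨hd, _, k4, k3⟩ := EE_bds L hL (t - y i) 0.4 (by norm_num) h
  have g1 := G0_bound L hL0 (a i) (b i) (t - y i) hd
  have k4' : EE L (t - y i) ^ 4 ≤ 39.1075 := k4.trans (by norm_num)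
  have k3' : EE L (t - y i) ^ 3 ≤ 16.394 := k3.trans (by norm_num)
  have := EE_nonneg L (t - y i)
  have g2 : |G0 L (a i) (b i) (t - y i)| ≤ (1.0341 * 39.1075 + 0.2853 * 16.394) / 97.4 := by
    refine g1.trans ?_
    have := ha i; have := hb i
    gcongr
  rw [← eτ]
  refine (abs_add_le _ _).trans ((add_le_add g2 g0).trans (by norm_num))

lemma S0_mid (hL : 64 ≤ L) (u v c w : ℝ) (hv : 0 ≤ v) (hvu : v ≤ |u|) (huw : |u| ≤ w) (hw : w ≤ 0.6)
    (hc1 : 1 - 1.6445 * v ^ 2 + 0.812 * v ^ 4 ≤ c) : |S0 L u| ≤ c := by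
  have hL0 : 0 < L := by omega
  have h1 := S0_lower L hL0 u
  have h2 := S0_upper L hL u (huw.trans hw)
  have hv2 : u ^ 2 = |u| ^ 2 := (sq_abs u).symm
  have e2 : v ^ 2 ≤ u ^ 2 := by rw [hv2]; gcongr
  have e3 : u ^ 2 ≤ 0.36 := by rw [hv2]; nlinarith [abs_nonneg u]
  rw [abs_le]
  constructor
  · nlinarith [sq_nonneg v, sq_nonneg (v^2)]
  · nlinarith

theorem cert (hL : 64 ≤ L) (hsep : ∀ i j, i ≠ j → 1 ≤ rho L (y i - y j)) (hs : ∀ i, |s i| = 1) :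
    ∃ a b : ι → ℝ, (∀ i, ∑ j, G0 L (a j) (b j) (y i - y j) = s i) ∧
      (∀ t, |∑ j, G0 L (a j) (b j) (t - y j)| ≤ 1) ∧
      (∀ t, (∀ i, 0.08 ≤ rho L (t - y i)) → |∑ j, G0 L (a j) (b j) (t - y j)| ≤ 0.995) := by
  have hL0 : 0 < L := by omega
  obtain ⟨a, b, h0, h1⟩ := exists_coeff L y hL hsep s
  have hap := apriori L y hL hsep a b 1 (fun i => by rw [h0 i, hs i]) h1
  have ha : ∀ i, |a i| ≤ 1.0341 := fun i => by have := (hap i).1; rwa [mul_one] at this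
  have hb : ∀ i, |b i| ≤ 0.2853 := fun i => by have := (hap i).2; rwa [mul_one] at this
  have main : ∀ t, |∑ j, G0 L (a j) (b j) (t - y j)| ≤ 0.995 ∨
      ∃ i, |∑ j, G0 L (a j) (b j) (t - y j)| ≤ 1 - 0.9 * rho L (t - y i) ^ 2 := by
    intro t
    rcases isEmpty_or_nonempty ι with hι | hι
    · left; simp; norm_num
    obtain ⟨i, hi⟩ := Finite.exists_min (fun i => rho L (t - y i))
    set τ := (t - y i) - round ((t - y i) / L) * L with hτ
    have hr : rho L (t - y i) = |τ| := rfl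
    have hper : ∑ j, G0 L (a j) (b j) (t - y j) = ∑ j, G0 L (a j) (b j) (y i + τ - y j) := by
      refine sum_congr rfl fun j _ => ?_
      rw [← G0_per L hL0 (a j) (b j) (y i + τ - y j) (round ((t - y i) / L))]
      congr 1
      rw [hτ]; ring
    by_cases c1 : |τ| ≤ 0.2
    · right; refine ⟨i, ?_⟩
      rw [hper, hr, sq_abs]
      exact near L y a b s hL hsep hs h0 h1 i τ c1
    left
    by_cases c2 : |τ| ≤ 0.3
    · rw [hper]
      refine mid L y a b hL hsep ha hb i τ 0.3 0.9356 8.949 7.52 (by norm_num) (by norm_num) c2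
        (by unfold Q4; norm_num) (by unfold Q3; norm_num) (by norm_num) ?_ (by norm_num)
      exact S0_mid L hL τ 0.2 _ 0.3 (by norm_num) (by linarith) c2 (by norm_num) (by norm_num)
    by_cases c3 : |τ| ≤ 0.4
    · rw [hper]
      refine mid L y a b hL hsep ha hb i τ 0.4 0.8586 16.2 11.31 (by norm_num) (by norm_num) c3
        (by unfold Q4; norm_num) (by unfold Q3; norm_num) (by norm_num) ?_ (by norm_num)
      exact S0_mid L hL τ 0.3 _ 0.4 (by norm_num) (by linarith) c3 (by norm_num) (by norm_num)
    exact far L y a b hL hsep ha hb i t hi (by rw [hr]; linarith)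
  refine ⟨a, b, h0, fun t => ?_, fun t ht => ?_⟩
  · rcases main t with h | ⟨i, h⟩
    · linarith
    · nlinarith [sq_nonneg (rho L (t - y i))]
  · rcases main t with h | ⟨i, h⟩
    · exact h
    · have := ht i
      nlinarith

end cert
end SD

namespace SD
open Real

lemma geo (N : ℕ) (hN : 0 < N) (c : ℤ) (hc : ¬ (N : ℤ) ∣ c) :
    ∑ n ∈ range N, Complex.exp (2 * π * Complex.I * c * n / N) = 0 := by
  have hN' : (N : ℂ) ≠ 0 := by exact_mod_cast hN.ne'
  set ζ := Complex.exp (2 * π * Complex.I * c / N) with hζ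
  have e : ∀ n ∈ range N, Complex.exp (2 * π * Complex.I * c * n / N) = ζ ^ n := by
    intro n _
    rw [hζ, ← Complex.exp_nat_mul]; congr 1; ring
  rw [sum_congr rfl e]
  have h1 : ζ ^ N = 1 := by
    rw [hζ, ← Complex.exp_nat_mul, Complex.exp_eq_one_iff]
    exact ⟨c, by field_simp⟩
  have h2 : ζ ≠ 1 := by
    intro h
    rw [hζ, Complex.exp_eq_one_iff] at h
    obtain ⟨n, hn⟩ := h
    apply hc
    refine ⟨n, ?_⟩
    have hp : (2 * π * Complex.I) ≠ 0 := Complex.two_pi_I_ne_zero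
    have : (c : ℂ) = N * n := by
      have : (2 * π * Complex.I) * c = (2 * π * Complex.I) * (N * n) := by
        field_simp at hn
        linear_combination (2 * π * Complex.I) * hn
      exact mul_left_cancel₀ hp this
    exact_mod_cast this
  have h3 := mul_geom_sum ζ N
  rw [h1, sub_self] at h3
  exact (mul_eq_zero.mp h3).resolve_left (sub_ne_zero.mpr h2)

/-- frequencies -/
noncomputable def EX (c : ℤ) : ℝ → ℂ := fun t => Complex.exp (Complex.I * π * c * t)
def IX (d : ℤ) : Set ℤ := {c | ∃ k : ℤ, c = d - 2 * k ∧ 0 ≤ k ∧ k ≤ d}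
noncomputable def VX (d : ℤ) : Submodule ℂ (ℝ → ℂ) := Submodule.span ℂ (EX '' IX d)

lemma IX_neg (d c : ℤ) (h : c ∈ IX d) : -c ∈ IX d := by
  obtain ⟨k, h1, h2, h3⟩ := h
  exact ⟨d - k, by omega, by omega, by omega⟩

lemma EX_mem (d c : ℤ) (h : c ∈ IX d) : EX c ∈ VX d := Submodule.subset_span ⟨c, h, rfl⟩

lemma VX_mul (d e : ℤ) (f g : ℝ → ℂ) (hf : f ∈ VX d) (hg : g ∈ VX e) : f * g ∈ VX (d + e) := by
  have h := Submodule.mul_mem_mul hf hg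
  unfold VX at h
  rw [Submodule.span_mul_span] at h
  refine Submodule.span_le.mpr ?_ h
  rintro _ ⟨_, ⟨c, ⟨k, hk⟩, rfl⟩, _, ⟨c', ⟨k', hk'⟩, rfl⟩, rfl⟩
  have : EX c * EX c' = EX (c + c') := by
    ext t
    simp only [EX, Pi.mul_apply, ← Complex.exp_add]
    congr 1; push_cast; ring
  show EX c * EX c' ∈ _
  rw [this]
  exact EX_mem _ _ ⟨k + k', by omega, by omega, by omega⟩

lemma cos_mem (d c : ℤ) (h : c ∈ IX d) (φ : ℝ) :
    (fun t : ℝ => ((cos (π * c * t + φ) : ℝ) : ℂ)) ∈ VX d := by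
  have : (fun t : ℝ => ((cos (π * c * t + φ) : ℝ) : ℂ)) =
      (Complex.exp (φ * Complex.I) / 2) • EX c + (Complex.exp (-(φ * Complex.I)) / 2) • EX (-c) := by
    ext t
    simp only [Pi.add_apply, Pi.smul_apply, smul_eq_mul, EX]
    rw [Complex.ofReal_cos, Complex.cos, div_mul_eq_mul_div, div_mul_eq_mul_div, ← Complex.exp_add,
      ← Complex.exp_add, ← add_div]
    congr 3 <;> (push_cast; ring)
  rw [this]
  exact Submodule.add_mem _ (Submodule.smul_mem _ _ (EX_mem _ _ h))
    (Submodule.smul_mem _ _ (EX_mem _ _ (IX_neg _ _ h)))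

lemma S0_mem (L : ℕ) (hL : 0 < L) (y : ℝ) : (fun t : ℝ => ((S0 L (L * t - y) : ℝ) : ℂ)) ∈ VX (L - 1) := by
  have hL' : (L : ℝ) ≠ 0 := by positivity
  have : (fun t : ℝ => ((S0 L (L * t - y) : ℝ) : ℂ)) =
      (1 / L : ℂ) • ∑ j ∈ range L, fun t : ℝ => ((cos (π * (2 * (j : ℤ) - L + 1 : ℤ) * t + (-(om L j * y))) : ℝ) : ℂ) := by
    ext t
    simp only [S0, Pi.smul_apply, Finset.sum_apply, smul_eq_mul]
    push_cast
    congr 1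
    refine sum_congr rfl fun j _ => ?_
    congr 1
    unfold om
    push_cast
    have : (L : ℂ) ≠ 0 := by exact_mod_cast hL'
    field_simp; ring
  rw [this]
  refine Submodule.smul_mem _ _ (Submodule.sum_mem _ fun j hj => cos_mem _ _ ?_ _)
  have := mem_range.mp hj
  exact ⟨L - 1 - j, by omega, by omega, by omega⟩

lemma lin_mem (L : ℕ) (hL : 0 < L) (a b y : ℝ) :
    (fun t : ℝ => ((a + b * sg L (L * t - y) : ℝ) : ℂ)) ∈ VX 2 := by
  have hL' : (L : ℝ) ≠ 0 := by positivity
  have : (fun t : ℝ => ((a + b * sg L (L * t - y) : ℝ) : ℂ)) =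
      (a : ℂ) • EX 0 + (b * (L / (2 * π)) : ℂ) • fun t : ℝ => ((cos (π * (2 : ℤ) * t + (-(2 * π * y / L) - π / 2)) : ℝ) : ℂ) := by
    ext t
    simp only [Pi.add_apply, Pi.smul_apply, smul_eq_mul, EX, sg]
    have : π * (2 : ℤ) * t + (-(2 * π * y / L) - π / 2) = 2 * π * (L * t - y) / L - π / 2 := by
      push_cast; field_simp; ring
    rw [this, cos_sub_pi_div_two]
    push_cast
    simp
    ring
  rw [this]
  exact Submodule.add_mem _ (Submodule.smul_mem _ _ (EX_mem _ _ ⟨1, by omega, by omega, by omega⟩))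
    (Submodule.smul_mem _ _ (cos_mem _ _ ⟨0, by omega, by omega, by omega⟩ _))

lemma G0_mem (L : ℕ) (hL : 0 < L) (a b y : ℝ) :
    (fun t : ℝ => ((G0 L a b (L * t - y) : ℝ) : ℂ)) ∈ VX (4 * L - 2) := by
  have h := S0_mem L hL y
  have h2 := VX_mul _ _ _ _ h h
  have h4 := VX_mul _ _ _ _ (VX_mul _ _ _ _ h2 h2) (lin_mem L hL a b y)
  have e : (L - 1 + (L - 1) + (L - 1 + (L - 1)) + 2 : ℤ) = 4 * L - 2 := by ring
  rw [e] at h4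
  refine (congrArg (· ∈ VX (4 * L - 2)) ?_).mpr h4
  funext t
  simp only [G0, Pi.mul_apply]
  push_cast; ring

lemma cos_sum (M : ℕ) (x : ℝ) : ((∑ k ∈ Icc (-(M : ℤ)) M, cos (k * x) : ℝ) : ℂ) =
    ∑ k ∈ Icc (-(M : ℤ)) M, Complex.exp (Complex.I * k * x) := by
  have h : ∑ k ∈ Icc (-(M : ℤ)) M, Complex.exp (Complex.I * k * x) =
      ∑ k ∈ Icc (-(M : ℤ)) M, Complex.exp (-(Complex.I * k * x)) := by
    refine sum_nbij' (fun k => -k) (fun k => -k) ?_ ?_ ?_ ?_ ?_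
    · intro k hk; rw [mem_Icc] at *; omega
    · intro k hk; rw [mem_Icc] at *; omega
    · simp
    · simp
    · intro k _; congr 1; push_cast; ring
  have h2 : ((∑ k ∈ Icc (-(M : ℤ)) M, cos (k * x) : ℝ) : ℂ) =
    ((∑ k ∈ Icc (-(M : ℤ)) M, Complex.exp (Complex.I * k * x)) +
      ∑ k ∈ Icc (-(M : ℤ)) M, Complex.exp (-(Complex.I * k * x))) / 2 := by
    rw [← sum_add_distrib, sum_div]
    push_cast
    refine sum_congr rfl fun k _ => ?_
    rw [Complex.cos]
    congr 3 <;> ring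
  rw [h2, ← h]; ring

lemma P_EX (N M : ℕ) (hN : 2 * M + 1 ≤ N) (κ : ℤ) (hκ : κ ∈ Icc (-(M : ℤ)) M) (m : Fin N) :
    ∑ n : Fin N, ((Pproj N M m n : ℝ) : ℂ) * EX (2 * κ) (((n : ℕ) : ℝ) / N) = EX (2 * κ) (((m : ℕ) : ℝ) / N) := by
  have hN0 : 0 < N := by omega
  have hN' : (N : ℂ) ≠ 0 := by exact_mod_cast hN0.ne'
  have e1 : ∀ n : Fin N, ((Pproj N M m n : ℝ) : ℂ) = (1 / N : ℂ) *
      ∑ k ∈ Icc (-(M : ℤ)) M, Complex.exp (2 * π * Complex.I * k * ((m : ℕ) - (n : ℕ)) / N) := by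
    intro n
    have := cos_sum M (2 * π * (((m : ℕ) : ℝ) - ((n : ℕ) : ℝ)) / N)
    have e : Pproj N M m n = (1 / (N : ℝ)) * ∑ k ∈ Icc (-(M : ℤ)) M, cos (k * (2 * π * (((m : ℕ) : ℝ) - ((n : ℕ) : ℝ)) / N)) := by
      unfold Pproj
      simp only [Matrix.of_apply]
      congr 1
      refine sum_congr rfl fun k _ => ?_
      congr 1; ring
    rw [e, Complex.ofReal_mul, this]
    push_cast
    congr 1
    refine sum_congr rfl fun k _ => ?_
    congr 1; ring
  have e2 : ∀ n : Fin N, ((Pproj N M m n : ℝ) : ℂ) * EX (2 * κ) (((n : ℕ) : ℝ) / N) =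
      ∑ k ∈ Icc (-(M : ℤ)) M, (1 / N : ℂ) * (Complex.exp (2 * π * Complex.I * k * (m : ℕ) / N) *
        Complex.exp (2 * π * Complex.I * (κ - k : ℤ) * (n : ℕ) / N)) := by
    intro n
    rw [e1, mul_assoc, sum_mul, mul_sum]
    refine sum_congr rfl fun k _ => ?_
    unfold EX
    rw [← Complex.exp_add, ← Complex.exp_add]
    congr 2
    push_cast
    field_simp; ring
  simp only [e2]
  rw [sum_comm]
  have e3 : ∀ k ∈ Icc (-(M : ℤ)) M, ∑ n : Fin N, (1 / N : ℂ) * (Complex.exp (2 * π * Complex.I * k * (m : ℕ) / N) *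
        Complex.exp (2 * π * Complex.I * (κ - k : ℤ) * (n : ℕ) / N)) =
        if k = κ then Complex.exp (2 * π * Complex.I * k * (m : ℕ) / N) else 0 := by
    intro k hk
    rw [← mul_sum, ← mul_sum, Fin.sum_univ_eq_sum_range (fun n => Complex.exp (2 * π * Complex.I * (κ - k : ℤ) * n / N))]
    split_ifs with h
    · subst h
      simp
      field_simp
    · rw [geo N hN0, mul_zero, mul_zero]
      intro hd
      rw [mem_Icc] at hk hκ
      have := Int.eq_zero_of_abs_lt_dvd hd (by rw [abs_lt]; constructor <;> omega)
      omega
  rw [sum_congr rfl e3, sum_ite_eq' , if_pos hκ]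
  unfold EX
  congr 1; push_cast; ring

lemma P_VX (N M L : ℕ) (hN : 2 * M + 1 ≤ N) (hL : 0 < L) (hLM : 2 * L ≤ M + 1) (f : ℝ → ℂ) (hf : f ∈ VX (4 * L - 2)) (m : Fin N) :
    ∑ n : Fin N, ((Pproj N M m n : ℝ) : ℂ) * f (((n : ℕ) : ℝ) / N) = f (((m : ℕ) : ℝ) / N) := by
  unfold VX at hf
  induction hf using Submodule.span_induction with
  | mem x h =>
    obtain ⟨c, ⟨k, h1, h2, h3⟩, rfl⟩ := h
    have : c = 2 * (2 * L - 1 - k) := by omega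
    rw [this]
    apply P_EX N M hN
    rw [mem_Icc]; omega
  | zero => simp
  | add x y _ _ hx hy => simp only [Pi.add_apply, mul_add, sum_add_distrib, hx, hy]
  | smul a x _ hx =>
    simp only [Pi.smul_apply, smul_eq_mul]
    rw [← hx, mul_sum]
    exact sum_congr rfl fun n _ => by ring

lemma P_cert {ι : Type*} [Fintype ι] (N M L : ℕ) (hN : 2 * M + 1 ≤ N) (hL : 0 < L) (hLM : 2 * L ≤ M + 1)
    (a b y : ι → ℝ) (m : Fin N) :
    ∑ n : Fin N, Pproj N M m n * ∑ j, G0 L (a j) (b j) (L * (((n : ℕ) : ℝ) / N) - y j) =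
      ∑ j, G0 L (a j) (b j) (L * (((m : ℕ) : ℝ) / N) - y j) := by
  have hf : (∑ j, fun t : ℝ => ((G0 L (a j) (b j) (L * t - y j) : ℝ) : ℂ)) ∈ VX (4 * L - 2) :=
    Submodule.sum_mem _ fun j _ => G0_mem L hL _ _ _
  have := P_VX N M L hN hL hLM _ hf m
  simp only [Finset.sum_apply] at this
  exact_mod_cast this

lemma P_symm (N M : ℕ) (m n : Fin N) : Pproj N M m n = Pproj N M n m := by
  unfold Pproj
  simp only [Matrix.of_apply]
  congr 1
  refine sum_congr rfl fun k _ => ?_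
  rw [← cos_neg]; congr 1; ring

lemma cs {N : ℕ} (f g : Fin N → ℝ) : ∑ n, f n * g n ≤ l2 f * l2 g := by
  unfold l2
  exact Real.sum_mul_le_sqrt_mul_sqrt _ _ _

lemma l2_le {N : ℕ} (g : Fin N → ℝ) (hg : ∀ n, |g n| ≤ 1) : l2 g ≤ sqrt N := by
  unfold l2
  apply Real.sqrt_le_sqrt
  calc ∑ n, g n ^ 2 ≤ ∑ n : Fin N, (1 : ℝ) := sum_le_sum fun n _ => by
        rw [← sq_abs]; have := hg n; have := abs_nonneg (g n); nlinarith
    _ = N := by simp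

lemma dual_bound {N M : ℕ} (g h : Fin N → ℝ) (hg : ∀ n, |g n| ≤ 1)
    (hP : ∀ m, ∑ n, Pproj N M m n * g n = g m) :
    - (∑ n, g n * h n) ≤ sqrt N * l2 ((Pproj N M).mulVec h) := by
  have e : ∑ n, g n * h n = ∑ n, g n * (Pproj N M).mulVec h n := by
    simp only [Matrix.mulVec, dotProduct, mul_sum]
    rw [sum_comm]
    refine sum_congr rfl fun n _ => ?_
    rw [← hP n, sum_mul]
    refine sum_congr rfl fun m _ => ?_
    rw [P_symm N M n m]; ring
  rw [e]
  have := cs (fun n => - g n) ((Pproj N M).mulVec h)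
  have h2 := l2_le (fun n => - g n) (fun n => by rw [abs_neg]; exact hg n)
  have h3 : 0 ≤ l2 ((Pproj N M).mulVec h) := Real.sqrt_nonneg _
  calc _ = ∑ n, -g n * (Pproj N M).mulVec h n := by simp
    _ ≤ _ := this
    _ ≤ _ := by gcongr

lemma geo_cos (N : ℕ) (hN : 0 < N) (c : ℤ) (hc : ¬ (N : ℤ) ∣ c) (s : ℤ) :
    ∑ k ∈ range N, cos (2 * π * (s + k) * c / N) = 0 := by
  have h := geo N hN c hc
  have : ((∑ k ∈ range N, cos (2 * π * (s + k) * c / N) : ℝ)) =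
      (Complex.exp (2 * π * Complex.I * s * c / N) * ∑ n ∈ range N, Complex.exp (2 * π * Complex.I * c * n / N)).re := by
    rw [mul_sum, Complex.re_sum]
    refine sum_congr rfl fun k _ => ?_
    rw [← Complex.exp_add, ← Complex.exp_ofReal_mul_I_re]
    congr 2
    push_cast; ring
  rw [this, h]; simp

lemma small_N (N M : ℕ) (hN : 0 < N) (hNM : N ≤ 2 * M + 1) (h : Fin N → ℝ) :
    l2 h ≤ l2 ((Pproj N M).mulVec h) := by
  have hN' : (0 : ℝ) < N := by positivity
  set Z : ℤ → ℝ := fun k => ∑ m : Fin N, ∑ n : Fin N, h m * h n * cos (2 * π * k * (((m : ℕ) : ℝ) - ((n : ℕ) : ℝ)) / N) with hZ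
  have hZ0 : ∀ k, 0 ≤ Z k := by
    intro k
    have : Z k = (∑ m : Fin N, h m * cos (2 * π * k * ((m : ℕ) : ℝ) / N)) ^ 2 +
        (∑ m : Fin N, h m * sin (2 * π * k * ((m : ℕ) : ℝ) / N)) ^ 2 := by
      rw [sq, sq, sum_mul_sum, sum_mul_sum, ← sum_add_distrib, hZ]
      refine sum_congr rfl fun m _ => ?_
      rw [← sum_add_distrib]
      refine sum_congr rfl fun n _ => ?_
      have : 2 * π * k * (((m : ℕ) : ℝ) - ((n : ℕ) : ℝ)) / N = 2 * π * k * ((m : ℕ) : ℝ) / N - 2 * π * k * ((n : ℕ) : ℝ) / N := by ring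
      rw [this, cos_sub]; ring
    rw [this]; positivity
  have e1 : ∑ n, h n * (Pproj N M).mulVec h n = (1 / N : ℝ) * ∑ k ∈ Icc (-(M : ℤ)) M, Z k := by
    simp only [Matrix.mulVec, dotProduct, mul_sum, hZ, Pproj, Matrix.of_apply, sum_mul]
    rw [sum_comm' (t' := univ) (s' := fun _ => Icc (-(M : ℤ)) M) (by simp)]
    refine sum_congr rfl fun m _ => ?_
    rw [sum_comm' (t' := univ) (s' := fun _ => Icc (-(M : ℤ)) M) (by simp)]
    refine sum_congr rfl fun n _ => ?_
    refine sum_congr rfl fun k _ => ?_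
    ring
  have e2 : ∑ k ∈ range N, Z (-(M : ℤ) + k) ≤ ∑ k ∈ Icc (-(M : ℤ)) M, Z k := by
    rw [← sum_image (s := range N) (g := fun k : ℕ => -(M : ℤ) + k) (f := Z) (by intro a _ b _ h; simpa using h)]
    apply sum_le_sum_of_subset_of_nonneg
    · intro k hk
      obtain ⟨j, hj, rfl⟩ := mem_image.mp hk
      rw [mem_range] at hj
      rw [mem_Icc]; omega
    · intro k _ _; exact hZ0 k
  have e3 : ∑ k ∈ range N, Z (-(M : ℤ) + k) = N * ∑ n, h n ^ 2 := by
    simp only [hZ]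
    rw [sum_comm, mul_sum]
    refine sum_congr rfl fun m _ => ?_
    rw [sum_comm, sum_eq_single m]
    · simp only [sub_self, mul_zero, zero_div, cos_zero, mul_one, sum_const, card_range, nsmul_eq_mul]
      ring
    · intro n _ hnm
      rw [← mul_sum]
      have := geo_cos N hN ((m : ℕ) - (n : ℕ) : ℤ) (by
        intro hd
        have h1 := m.2
        have h2 := n.2
        have := Int.eq_zero_of_abs_lt_dvd hd (by rw [abs_lt]; constructor <;> omega)
        apply hnm
        ext; omega) (-(M : ℤ))
      push_cast at this ⊢
      rw [this, mul_zero]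
    · simp
  have e4 : ∑ n, h n ^ 2 ≤ ∑ n, h n * (Pproj N M).mulVec h n := by
    rw [e1]
    rw [e3] at e2
    rw [one_div, ← div_eq_inv_mul, le_div_iff₀ hN']
    linarith
  have e5 := cs h ((Pproj N M).mulVec h)
  have e6 : l2 h ^ 2 = ∑ n, h n ^ 2 := Real.sq_sqrt (sum_nonneg fun n _ => sq_nonneg _)
  have e7 : 0 ≤ l2 h := Real.sqrt_nonneg _
  have e8 : 0 ≤ l2 ((Pproj N M).mulVec h) := Real.sqrt_nonneg _
  by_contra hcon
  push Not at hcon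
  nlinarith

lemma l1_le {N : ℕ} (h : Fin N → ℝ) : ∑ n, |h n| ≤ sqrt N * l2 h := by
  have := cs (fun _ : Fin N => (1 : ℝ)) (fun n => |h n|)
  have h2 := l2_le (fun _ : Fin N => (1 : ℝ)) (by simp)
  have h3 : l2 (fun n => |h n|) = l2 h := by unfold l2; simp
  have h4 : 0 ≤ l2 h := Real.sqrt_nonneg _
  simp only [one_mul] at this
  rw [h3] at this
  exact this.trans (by gcongr)

end SD

namespace SD
open Real

lemma rho_wrap (L N : ℕ) (hL : 0 < L) (hN : 0 < N) (m n : Fin N) :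
    L * ((wrapDist N m n : ℝ) / N) ≤ rho L (L * (((m : ℕ) : ℝ) / N) - L * (((n : ℕ) : ℝ) / N)) := by
  have hL' : (0 : ℝ) < L := by positivity
  have hN' : (0 : ℝ) < N := by positivity
  unfold rho
  generalize round ((L * (((m : ℕ) : ℝ) / N) - L * (((n : ℕ) : ℝ) / N)) / L) = z
  have e : L * (((m : ℕ) : ℝ) / N) - L * (((n : ℕ) : ℝ) / N) - z * L =
      L / N * (((m : ℕ) - (n : ℕ) - z * N : ℤ) : ℝ) := by
    push_cast; field_simp
  rw [e, abs_mul, abs_of_pos (by positivity)]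
  have key : (wrapDist N m n : ℤ) ≤ |((m : ℕ) - (n : ℕ) - z * N : ℤ)| := by
    unfold wrapDist
    rw [Int.abs_eq_natAbs]
    have h1 := m.2
    have h2 := n.2
    rcases lt_trichotomy z 0 with hz | hz | hz
    · have : z * N ≤ -N := by nlinarith
      generalize z * (N : ℤ) = w at *
      omega
    · subst hz; simp only [zero_mul]; omega
    · have : (N : ℤ) ≤ z * N := by nlinarith
      generalize z * (N : ℤ) = w at *
      omega
  have key' : (wrapDist N m n : ℝ) ≤ |(((m : ℕ) - (n : ℕ) - z * N : ℤ) : ℝ)| := by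
    have : ((wrapDist N m n : ℤ) : ℝ) ≤ ((|((m : ℕ) - (n : ℕ) - z * N : ℤ)| : ℤ) : ℝ) := by
      exact_mod_cast key
    rw [Int.cast_abs] at this
    exact this
  calc L * ((wrapDist N m n : ℝ) / N) = L / N * wrapDist N m n := by ring
    _ ≤ _ := by gcongr

lemma wrap_self (N : ℕ) (n : Fin N) : wrapDist N n n = 0 := by
  unfold wrapDist; simp

lemma l1_arg {N M : ℕ} (v h g : Fin N → ℝ) (far : Fin N → Prop)
    (hmin : ∑ n, |v n + h n| ≤ ∑ n, |v n|)
    (hgS : ∀ n, v n ≠ 0 → g n = SignType.sign (v n)) (hg1 : ∀ n, |g n| ≤ 1)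
    (hfar : ∀ n, far n → v n = 0 ∧ |g n| ≤ 0.995) :
    0.005 * ∑ n ∈ univ.filter far, |h n| ≤ - ∑ n, g n * h n := by
  have pt : ∀ n, |v n| + g n * h n + (if far n then 0.005 * |h n| else 0) ≤ |v n + h n| := by
    intro n
    have hgh : g n * h n ≤ |g n| * |h n| := by rw [← abs_mul]; exact le_abs_self _
    have hh := abs_nonneg (h n)
    split_ifs with hf
    · obtain ⟨h0, h1⟩ := hfar n hf
      rw [h0, abs_zero, zero_add, zero_add]
      nlinarith
    · by_cases h0 : v n = 0
      · rw [h0, abs_zero, zero_add, zero_add]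
        nlinarith [hg1 n]
      · rw [hgS n h0]
        rcases lt_or_gt_of_ne h0 with hv | hv
        · rw [sign_neg hv, abs_of_neg hv]
          have := neg_abs_le (v n + h n)
          simp only [SignType.coe_neg, SignType.coe_one]
          linarith
        · rw [sign_pos hv, abs_of_pos hv]
          have := le_abs_self (v n + h n)
          simp only [SignType.coe_one]
          linarith
  have := sum_le_sum (s := univ) fun n _ => pt n
  rw [sum_add_distrib, sum_add_distrib, ← sum_filter, ← mul_sum] at this
  linarith

end SD

/-- the part of `h = D₁^β(x̂-x)` living on grid points away from
every support point of `D₁^β x` (at torus distance `> 0.16/M`) has ℓ¹ mass at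
most `C √N ‖P_M h‖₂`. -/
theorem sigma_delta_dual_certificate_far_bound :
    ∃ C : ℝ, 0 < C ∧
      ∀ (N β r M : ℕ), (β = 1 ∨ β = 2) → β ≤ r → 128 ≤ M →
      ∀ (δ : ℝ), 0 < δ →
      ∀ (x q xhat : Fin N → ℝ),
        (∀ i, x i ∈ Set.Icc (0 : ℝ) 1) →
        minSep N M ((D1mat N ^ β).mulVec x) →
        (∀ i, |(((Dmat N)⁻¹ ^ r).mulVec (x - q)) i| ≤ δ / 2) →
        (∀ i, |(((Dmat N)⁻¹ ^ r).mulVec (xhat - q)) i| ≤ δ / 2) →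
        l1 ((D1mat N ^ β).mulVec xhat) ≤ l1 ((D1mat N ^ β).mulVec x) →
        ∑ n ∈ Finset.univ.filter (fun n : Fin N =>
            ∀ m : Fin N, ((D1mat N ^ β).mulVec x) m ≠ 0 →
              (0.16 : ℝ) / M < (wrapDist N n m : ℝ) / N),
          |((D1mat N ^ β).mulVec (xhat - x)) n| ≤
        C * Real.sqrt N * l2 ((Pproj N M).mulVec ((D1mat N ^ β).mulVec (xhat - x))) := by
  refine ⟨200, by norm_num, ?_⟩
  intro N β r M _ _ hM δ _ x q xhat _ hsep _ _ hmin
  have hv : (D1mat N ^ β).mulVec xhat = fun n => ((D1mat N ^ β).mulVec x) n + ((D1mat N ^ β).mulVec (xhat - x)) n := by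
    rw [Matrix.mulVec_sub]; funext n; simp
  rw [hv] at hmin
  generalize (D1mat N ^ β).mulVec x = v at *
  generalize (D1mat N ^ β).mulVec (xhat - x) = h at *
  have hP0 : 0 ≤ l2 ((Pproj N M).mulVec h) := Real.sqrt_nonneg _
  have hs0 := Real.sqrt_nonneg (N : ℝ)
  rcases Nat.eq_zero_or_pos N with hN | hN
  · subst hN; simp
  have hN' : (0 : ℝ) < N := by positivity
  have hM' : (128 : ℝ) ≤ M := by exact_mod_cast hM
  rcases Nat.lt_or_ge (2 * M) N with hNM | hNM
  · set L := (M + 1) / 2 with hL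
    have hL64 : 64 ≤ L := by omega
    have hL0 : 0 < L := by omega
    have hLM : 2 * L ≤ M + 1 := by omega
    have hML : M ≤ 2 * L := by omega
    have hML' : (M : ℝ) ≤ 2 * L := by exact_mod_cast hML
    have hM0 : (0 : ℝ) < M := by linarith
    have hL0' : (0 : ℝ) < L := by positivity
    obtain ⟨a, b, c1, c2, c3⟩ := SD.cert (ι := {m : Fin N // v m ≠ 0}) L
      (fun i => L * (((i.1 : ℕ) : ℝ) / N)) (fun i => (SignType.sign (v i.1) : ℝ)) hL64 (by
        intro i j hij
        have h1 := SD.rho_wrap L N hL0 hN i.1 j.1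
        have h2 := hsep i.1 j.1 i.2 j.2 (fun e => hij (Subtype.ext e))
        refine le_trans ?_ h1
        calc (1 : ℝ) ≤ L * (2 / M) := by rw [← mul_div_assoc, le_div_iff₀ hM0]; linarith
          _ ≤ _ := by gcongr) (by
        intro i
        rcases lt_or_gt_of_ne i.2 with hi | hi
        · rw [sign_neg hi]; simp
        · rw [sign_pos hi]; simp)
    set y : {m : Fin N // v m ≠ 0} → ℝ := fun i => L * (((i.1 : ℕ) : ℝ) / N) with hy
    set g : Fin N → ℝ := fun n => ∑ j, SD.G0 L (a j) (b j) (L * (((n : ℕ) : ℝ) / N) - y j) with hg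
    have hl1 := SD.l1_arg (M := M) v h g (fun n : Fin N => ∀ m : Fin N, v m ≠ 0 →
              (0.16 : ℝ) / M < (wrapDist N n m : ℝ) / N) hmin (fun n hn => c1 ⟨n, hn⟩) (fun n => c2 _) (by
        intro n hn
        constructor
        · by_contra h0
          have := hn n h0
          rw [SD.wrap_self] at this
          have h2 : (0 : ℝ) ≤ 0.16 / M := by positivity
          simp at this
          linarith
        · apply c3
          intro i
          have h1 := SD.rho_wrap L N hL0 hN n i.1
          have h2 := hn i.1 i.2
          refine le_trans ?_ h1
          calc (0.08 : ℝ) ≤ L * (0.16 / M) := by rw [← mul_div_assoc, le_div_iff₀ hM0]; linarith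
            _ ≤ _ := by gcongr)
    have hd := SD.dual_bound (M := M) g h (fun n => c2 _) (fun m => SD.P_cert N M L (by omega) hL0 hLM a b y m)
    have := hl1.trans hd
    linarith
  · have h1 := SD.small_N N M hN (by omega) h
    have h2 := SD.l1_le h
    have h3 : ∑ n ∈ Finset.univ.filter (fun n : Fin N =>
            ∀ m : Fin N, v m ≠ 0 → (0.16 : ℝ) / M < (wrapDist N n m : ℝ) / N), |h n| ≤ ∑ n, |h n| :=
      sum_le_sum_of_subset_of_nonneg (filter_subset _ _) fun n _ _ => abs_nonneg _
    have h4 : √(N : ℝ) * l2 h ≤ √(N : ℝ) * l2 ((Pproj N M).mulVec h) := by gcongr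
    have h5 : 0 ≤ √(N : ℝ) * l2 ((Pproj N M).mulVec h) := by positivity
    linarith
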